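/- arXiv:2012.00979 — 3 statements merged into one kernel-verified Lean document; each statement's English description precedes it below -/
import Mathlib

section
/- Let t > 1 and c > 0 be integers, G an abelian group of order t²c², U a subgroup of order tc, and P₁,…,P_t subsets of G each of size c(tc-1). Then {P₁,…,P_t} is a (c,t) LP-packing in G relative to U if and only if for every nonprincipal character χ of G, the multiset {χ(P₁),…,χ(P_t)} equals {-c,…,-c} when χ is principal on U, and equals {(t-1)c, -c,…,-c} when χ is nonprincipal on U. -/
open Finset BigOperators

variable {G : Type*}

/-- Number of ordered pairs `(x,y)` with `x,y ∈ D`, `x ≠ y`, `x * y⁻¹ = g`. -/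
noncomputable def diffCount [Group G] (D : Set G) (g : G) : ℕ :=
  Nat.card {p : G × G // p.1 ∈ D ∧ p.2 ∈ D ∧ p.1 ≠ p.2 ∧ p.1 * p.2⁻¹ = g}

/-- `D` is a `(v,k,λ,μ)` partial difference set in `G`. -/
def IsPDS [Group G] (D : Set G) (v k : ℕ) (l m : ℤ) : Prop :=
  Nat.card G = v ∧ Nat.card D = k ∧
    ∀ g : G, g ≠ 1 →
      (g ∈ D → (diffCount D g : ℤ) = l) ∧ (g ∉ D → (diffCount D g : ℤ) = m)

/-- A regular PDS: a PDS avoiding the identity and closed under inversion. -/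
def IsRegularPDS [Group G] (D : Set G) (v k : ℕ) (l m : ℤ) : Prop :=
  IsPDS D v k l m ∧ (1 : G) ∉ D ∧ D⁻¹ = D

/-- A regular `(n,r)` Latin square type PDS. -/
def IsLatinPDS [Group G] (D : Set G) (n r : ℕ) : Prop :=
  IsRegularPDS D (n ^ 2) (r * (n - 1)) ((n : ℤ) + (r : ℤ) ^ 2 - 3 * r) ((r : ℤ) ^ 2 - r)

/-- A regular `(n,r)` negative Latin square type PDS. -/
def IsNegLatinPDS [Group G] (D : Set G) (n r : ℕ) : Prop :=
  IsRegularPDS D (n ^ 2) (r * (n + 1)) (-(n : ℤ) + (r : ℤ) ^ 2 + 3 * r) ((r : ℤ) ^ 2 + r)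

/-- Character sum `χ(D) = ∑_{d ∈ D} χ(d)`. -/
noncomputable def charSum [Group G] (χ : G →* ℂˣ) (D : Set G) : ℂ :=
  ∑ᶠ d ∈ D, (χ d : ℂ)

/-- The multiset of character sums `{χ(P 0), …, χ(P (t-1))}`. -/
noncomputable def charMultiset [Group G] {t : ℕ} (χ : G →* ℂˣ) (P : Fin t → Set G) :
    Multiset ℂ :=
  (Finset.univ.val : Multiset (Fin t)).map fun i => charSum χ (P i)

/-- `χ` is principal on the subgroup `U`. -/
def IsPrincipalOn [Group G] (χ : G →* ℂˣ) (U : Subgroup G) : Prop :=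
  ∀ u ∈ U, χ u = 1

/-- A `(c,t)` LP-packing in `G` relative to `U`. -/
def IsLPPacking [CommGroup G] (c t : ℕ) (P : Fin t → Set G) (U : Subgroup G) : Prop :=
  Nat.card G = t ^ 2 * c ^ 2 ∧ Nat.card U = t * c ∧
    (∀ i, IsLatinPDS (P i) (t * c) c) ∧
    (∀ i j, i ≠ j → Disjoint (P i) (P j)) ∧
    (⋃ i, P i) = Set.univ \ (U : Set G)

/-- A `(c,t-1)` NLP-packing in `G`. -/
def IsNLPPacking [CommGroup G] (c t : ℕ) (P : Fin (t - 1) → Set G) : Prop :=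
  Nat.card G = t ^ 2 * c ^ 2 ∧
    (∀ i, IsNegLatinPDS (P i) (t * c) c) ∧
    IsNegLatinPDS (Set.univ \ ({1} ∪ ⋃ i, P i)) (t * c) (c - 1)

/-- A `(c,t)` LP-partition in `G − V` relative to `H`. -/
def IsLPPartition [CommGroup G] (c t : ℕ) (R : Fin t → Set G) (V H : Subgroup G) : Prop :=
  Nat.card G = t ^ 2 * c ^ 2 ∧ Nat.card V = t * c ^ 2 ∧ H ≤ V ∧
    (∀ i, Nat.card (R i) = (t - 1) * c ^ 2) ∧
    (∀ i j, i ≠ j → Disjoint (R i) (R j)) ∧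
    (⋃ i, R i) = Set.univ \ (V : Set G) ∧
    ∀ χ : G →* ℂˣ, χ ≠ 1 →
      (IsPrincipalOn χ V → charMultiset χ R = Multiset.replicate t (-(c : ℂ) ^ 2)) ∧
      (¬ IsPrincipalOn χ V → IsPrincipalOn χ H →
        charMultiset χ R = Multiset.replicate t 0) ∧
      (¬ IsPrincipalOn χ H →
        charMultiset χ R = ((t : ℂ) - 1) * (c : ℂ) ::ₘ Multiset.replicate (t - 1) (-(c : ℂ)))

section Fourier

variable [CommGroup G] [Fintype G]

/-- Fourier transform of a function on a finite abelian group, at the character `χ`. -/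
noncomputable def charTransform (f : G → ℂ) (χ : G →* ℂˣ) : ℂ :=
  ∑ g, f g * (χ g : ℂ)

lemma sum_char_apply_eq_zero [Fintype (G →* ℂˣ)] {g : G} (hg : g ≠ 1) :
    ∑ χ : G →* ℂˣ, (χ g : ℂ) = 0 := by
  have : NeZero (Monoid.exponent G) := ⟨Monoid.exponent_ne_zero_of_finite⟩
  obtain ⟨ψ, hψ⟩ := CommGroup.exists_apply_ne_one_of_hasEnoughRootsOfUnity G ℂ hg
  have h : (ψ g : ℂ) * ∑ χ : G →* ℂˣ, (χ g : ℂ) = ∑ χ : G →* ℂˣ, (χ g : ℂ) := by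
    rw [Finset.mul_sum]
    exact Fintype.sum_equiv (Equiv.mulLeft ψ) _ _ fun χ => by simp
  have hψ' : (ψ g : ℂ) - 1 ≠ 0 := sub_ne_zero.2 fun h => hψ (Units.ext h)
  refine (mul_eq_zero.1 ?_).resolve_left hψ'
  rw [sub_mul, h, one_mul, sub_self]

lemma charTransform_inversion [Fintype (G →* ℂˣ)] (f : G → ℂ) (a : G) :
    ∑ χ : G →* ℂˣ, charTransform f χ * (χ a⁻¹ : ℂ) = Fintype.card (G →* ℂˣ) * f a := by
  classical
  simp only [charTransform, Finset.sum_mul]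
  rw [Finset.sum_comm, Finset.sum_eq_single a]
  · simp
  · intro g _ hg
    have h := sum_char_apply_eq_zero (G := G) (g := g * a⁻¹) (by simpa [mul_inv_eq_one] using hg)
    simp only [map_mul, Units.val_mul] at h
    simp only [mul_assoc, ← Finset.mul_sum, h, mul_zero]
  · simp

lemma charTransform_injective {f h : G → ℂ} (H : ∀ χ, charTransform f χ = charTransform h χ) :
    f = h := by
  have : NeZero (Monoid.exponent G) := ⟨Monoid.exponent_ne_zero_of_finite⟩
  have : Finite (G →* ℂˣ) := inferInstance
  have := Fintype.ofFinite (G →* ℂˣ)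
  funext a
  have h1 := charTransform_inversion f a
  have h2 := charTransform_inversion h a
  simp only [H] at h1
  have hc : (Fintype.card (G →* ℂˣ) : ℂ) ≠ 0 := by exact_mod_cast Fintype.card_ne_zero
  exact mul_left_cancel₀ hc (h1.symm.trans h2)

lemma charSum_eq_charTransform (χ : G →* ℂˣ) (D : Set G) :
    charSum χ D = charTransform (D.indicator 1) χ := by
  classical
  rw [charSum, finsum_mem_def, finsum_eq_sum_of_fintype, charTransform]
  refine Finset.sum_congr rfl fun g _ => ?_
  by_cases h : g ∈ D <;> simp [h]

lemma charSum_one (D : Set G) : charSum (1 : G →* ℂˣ) D = Nat.card D := by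
  classical
  rw [charSum_eq_charTransform, charTransform, Nat.card_eq_fintype_card, Fintype.card_subtype]
  simp [Set.indicator_apply]

lemma sum_char_eq_zero {χ : G →* ℂˣ} (hχ : χ ≠ 1) : ∑ g, (χ g : ℂ) = 0 :=
  sum_hom_units_eq_zero ((Units.coeHom ℂ).comp χ) fun h =>
    hχ (MonoidHom.ext fun g => Units.ext (by simpa using DFunLike.congr_fun h g))

lemma charSum_subgroup_of_isPrincipalOn {χ : G →* ℂˣ} {U : Subgroup G}
    (h : IsPrincipalOn χ U) : charSum χ (U : Set G) = Nat.card U := by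
  rw [← SetLike.coe_sort_coe, ← charSum_one, charSum, charSum]
  exact finsum_mem_congr rfl fun g hg => by rw [h g hg]; rfl

lemma charSum_subgroup_of_not_isPrincipalOn {χ : G →* ℂˣ} {U : Subgroup G}
    (h : ¬ IsPrincipalOn χ U) : charSum χ (U : Set G) = 0 := by
  classical
  have hne : χ.comp U.subtype ≠ 1 := fun h1 => h fun u hu => DFunLike.congr_fun h1 ⟨u, hu⟩
  have := Fintype.ofFinite U
  have h0 := sum_char_eq_zero hne
  rw [charSum, ← finsum_set_coe_eq_finsum_mem]
  exact (finsum_eq_sum_of_fintype _).trans h0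

lemma charSum_add_charSum_compl {χ : G →* ℂˣ} (hχ : χ ≠ 1) (D : Set G) :
    charSum χ (Set.univ \ D) = - charSum χ D := by
  rw [eq_neg_iff_add_eq_zero, ← sum_char_eq_zero hχ, charSum_eq_charTransform,
    charSum_eq_charTransform, charTransform, charTransform, ← Finset.sum_add_distrib]
  refine Finset.sum_congr rfl fun g _ => ?_
  by_cases h : g ∈ D <;> simp [h]

lemma conj_char_apply (χ : G →* ℂˣ) (g : G) :
    (starRingEnd ℂ) (χ g : ℂ) = (χ g⁻¹ : ℂ) := by
  have h : ((χ g : ℂˣ) : ℂ) ^ Fintype.card G = 1 := by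
    rw [← Units.val_pow_eq_pow_val, ← map_pow, pow_card_eq_one, map_one, Units.val_one]
  rw [map_inv, Units.val_inv_eq_inv_val,
    Complex.inv_eq_conj (Complex.norm_eq_one_of_pow_eq_one h Fintype.card_ne_zero)]

lemma charSum_inv_set (χ : G →* ℂˣ) (D : Set G) :
    charSum χ D⁻¹ = (starRingEnd ℂ) (charSum χ D) := by
  rw [charSum_eq_charTransform, charSum_eq_charTransform, charTransform, charTransform, map_sum]
  refine Fintype.sum_equiv (Equiv.inv G) _ _ fun g => ?_
  rw [map_mul, conj_char_apply]
  by_cases h : g⁻¹ ∈ D <;> simp [h]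

lemma eq_of_charSum_eq {A B : Set G} (h : ∀ χ, charSum χ A = charSum χ B) : A = B :=
  Set.indicator_one_inj ℂ <| charTransform_injective fun χ => by
    simpa only [charSum_eq_charTransform] using h χ

/-- Number of pairs in `D × D` with quotient `g`. -/
noncomputable def quotientCount (D : Set G) (g : G) : ℂ :=
  ∑ y, D.indicator 1 (g * y) * D.indicator 1 y

lemma charTransform_quotientCount (D : Set G) (χ : G →* ℂˣ) :
    charTransform (quotientCount D) χ = charSum χ D * (starRingEnd ℂ) (charSum χ D) := by
  rw [charSum_eq_charTransform]
  simp only [charTransform, quotientCount, map_sum, Finset.sum_mul]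
  rw [Finset.sum_comm]
  simp only [Finset.mul_sum]
  rw [Finset.sum_comm (s := univ (α := G)) (t := univ (α := G))
    (f := fun x y => D.indicator (1 : G → ℂ) x * (χ x : ℂ) *
      (starRingEnd ℂ) (D.indicator (1 : G → ℂ) y * (χ y : ℂ)))]
  refine Finset.sum_congr rfl fun y _ => ?_
  refine Fintype.sum_equiv (Equiv.mulRight y) _ _ fun g => ?_
  have h : (starRingEnd ℂ) (D.indicator (1 : G → ℂ) y) = D.indicator 1 y := by
    by_cases h : y ∈ D <;> simp [h]
  have h2 : (χ y : ℂ) * (χ y⁻¹ : ℂ) = 1 := by simp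
  simp only [Equiv.coe_mulRight, map_mul, Units.val_mul, conj_char_apply, h]
  linear_combination (-D.indicator (1 : G → ℂ) (g * y) * D.indicator 1 y * (χ g : ℂ)) * h2

lemma quotientCount_one (D : Set G) : quotientCount D 1 = Nat.card D := by
  rw [← charSum_one, charSum_eq_charTransform, charTransform, quotientCount]
  refine Finset.sum_congr rfl fun g _ => ?_
  by_cases h : g ∈ D <;> simp [h]

lemma quotientCount_of_ne_one (D : Set G) {g : G} (hg : g ≠ 1) :
    quotientCount D g = diffCount D g := by
  classical
  have e : {p : G × G // p.1 ∈ D ∧ p.2 ∈ D ∧ p.1 ≠ p.2 ∧ p.1 * p.2⁻¹ = g} ≃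
      {y : G // g * y ∈ D ∧ y ∈ D} :=
    { toFun := fun p => ⟨p.1.2, by
        obtain ⟨⟨x, y⟩, hx, hy, -, rfl⟩ := p
        exact ⟨by simpa using hx, hy⟩⟩
      invFun := fun y => ⟨(g * y.1, y.1), y.2.1, y.2.2, by simpa using hg, by simp⟩
      left_inv := by
        rintro ⟨⟨x, y⟩, hx, hy, hne, rfl⟩
        simp
      right_inv := fun y => rfl }
  rw [diffCount, Nat.card_congr e, Nat.card_eq_fintype_card, Fintype.card_subtype, quotientCount,
    Finset.card_filter, Nat.cast_sum]
  refine Finset.sum_congr rfl fun y _ => ?_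
  by_cases h : g * y ∈ D <;> by_cases h' : y ∈ D <;> simp [h, h']

lemma isRegularPDS_iff_quotientCount (D : Set G) (v k : ℕ) (l m : ℤ) :
    IsRegularPDS D v k l m ↔ Nat.card G = v ∧ Nat.card D = k ∧ (1 : G) ∉ D ∧ D⁻¹ = D ∧
      quotientCount D = fun g => ((l : ℂ) - m) * D.indicator 1 g +
        ((k : ℂ) - m) * ({1} : Set G).indicator 1 g + m * (Set.univ : Set G).indicator 1 g := by
  constructor
  · rintro ⟨⟨hv, hk, h⟩, h1, hi⟩
    refine ⟨hv, hk, h1, hi, funext fun g => ?_⟩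
    by_cases hg : g = 1
    · subst hg
      rw [quotientCount_one, hk]
      simp [h1]
    · rw [quotientCount_of_ne_one D hg]
      by_cases hD : g ∈ D
      · have := (h g hg).1 hD
        rw [← Int.cast_natCast, this]
        simp [hD, hg]
      · have := (h g hg).2 hD
        rw [← Int.cast_natCast, this]
        simp [hD, hg]
  · rintro ⟨hv, hk, h1, hi, h⟩
    refine ⟨⟨hv, hk, fun g hg => ?_⟩, h1, hi⟩
    have := congrFun h g
    rw [quotientCount_of_ne_one D hg] at this
    constructor
    · intro hD
      simp only [hD, hg, Set.indicator_of_mem, Set.mem_singleton_iff, not_false_eq_true,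
        Set.indicator_of_notMem, Set.mem_univ, Pi.one_apply] at this
      have h2 : ((diffCount D g : ℤ) : ℂ) = (l : ℂ) := by push_cast; linear_combination this
      exact_mod_cast h2
    · intro hD
      simp only [hD, hg, Set.indicator_of_mem, Set.mem_singleton_iff, not_false_eq_true,
        Set.indicator_of_notMem, Set.mem_univ, Pi.one_apply] at this
      have h2 : ((diffCount D g : ℤ) : ℂ) = (m : ℂ) := by push_cast; linear_combination this
      exact_mod_cast h2

lemma charTransform_linear (a b d : ℂ) (D : Set G) (χ : G →* ℂˣ) :
    charTransform (fun g => a * D.indicator 1 g + b * ({1} : Set G).indicator 1 g +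
      d * (Set.univ : Set G).indicator 1 g) χ =
      a * charSum χ D + b + d * charSum χ Set.univ := by
  classical
  have h1 : charTransform (({1} : Set G).indicator 1) χ = 1 := by
    simp [charTransform, Set.indicator_apply]
  rw [charSum_eq_charTransform, charSum_eq_charTransform]
  conv_rhs => rw [← mul_one b, ← h1]
  simp only [charTransform, Finset.mul_sum, ← Finset.sum_add_distrib]
  exact Finset.sum_congr rfl fun g _ => by ring

lemma charSum_univ {χ : G →* ℂˣ} (hχ : χ ≠ 1) : charSum χ Set.univ = 0 := by
  rw [charSum_eq_charTransform, charTransform, ← sum_char_eq_zero hχ]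
  simp

/-- A set of the right size avoiding the identity is a regular Latin square type PDS exactly when its
nontrivial character values are the two expected ones. -/
lemma isLatinPDS_iff_charSum {c t : ℕ} (hc : 0 < c) (ht : 0 < t)
    (hG : Nat.card G = t ^ 2 * c ^ 2) {D : Set G} (hD : Nat.card D = c * (t * c - 1))
    (h1 : (1 : G) ∉ D) :
    IsLatinPDS D (t * c) c ↔
      ∀ χ : G →* ℂˣ, χ ≠ 1 → charSum χ D = -c ∨ charSum χ D = ((t : ℂ) - 1) * c := by
  have hk : ((c * (t * c - 1) : ℕ) : ℂ) = c * (t * c - 1) := by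
    rw [Nat.cast_mul, Nat.cast_sub (Nat.mul_pos ht hc)]; push_cast; ring
  rw [IsLatinPDS, isRegularPDS_iff_quotientCount]
  constructor
  · rintro ⟨-, -, -, hi, h⟩ χ hχ
    have h2 := congrArg (fun f => charTransform f χ) h
    rw [charTransform_quotientCount, charTransform_linear, charSum_univ hχ, ← charSum_inv_set, hi,
      hk] at h2
    push_cast at h2
    rw [← sub_eq_zero, ← sub_eq_zero (b := ((t : ℂ) - 1) * c), ← mul_eq_zero]
    linear_combination h2
  · intro h
    have hreal : ∀ χ, (starRingEnd ℂ) (charSum χ D) = charSum χ D := by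
      intro χ
      by_cases hχ : χ = 1
      · subst hχ
        rw [charSum_one, Complex.conj_natCast]
      · rcases h χ hχ with h | h <;> simp [h]
    refine ⟨by rw [hG]; ring, hD, h1, eq_of_charSum_eq fun χ => ?_,
      charTransform_injective fun χ => ?_⟩
    · rw [charSum_inv_set, hreal]
    · rw [charTransform_quotientCount, charTransform_linear, hreal, hk]
      by_cases hχ : χ = 1
      · subst hχ
        rw [charSum_one, charSum_one, hD, hk, Nat.card_congr (Equiv.Set.univ G), hG]
        push_cast
        ring
      · rw [charSum_univ hχ]
        push_cast
        rcases h χ hχ with h | h <;> rw [h] <;> ring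

end Fourier

section TwoValued

variable {t c : ℕ} {f : Fin t → ℂ}

/-- If `f` takes only the values `-c` and `(t-1)c`, its sum counts the latter value. -/
lemma sum_eq_of_two_valued (h : ∀ i, f i = -c ∨ f i = ((t : ℂ) - 1) * c) :
    ∑ i, f i = t * c * ((#{i | f i ≠ -c} : ℂ) - 1) := by
  classical
  have h1 : ∀ i, f i = -c + t * c * (if f i ≠ -c then 1 else 0) := by
    intro i
    by_cases hi : f i = -c
    · simp [hi]
    · rw [if_pos hi, (h i).resolve_left hi]
      ring
  rw [Finset.sum_congr rfl fun i _ => h1 i, Finset.sum_add_distrib, ← Finset.mul_sum,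
    Finset.sum_boole]
  simp only [sum_const, card_univ, Fintype.card_fin, nsmul_eq_mul]
  ring

lemma map_eq_replicate_of_sum (hc : 0 < c) (ht : 0 < t)
    (h : ∀ i, f i = -c ∨ f i = ((t : ℂ) - 1) * c) (hs : ∑ i, f i = -(t * c)) :
    (univ : Finset (Fin t)).val.map f = Multiset.replicate t (-(c : ℂ)) := by
  classical
  have hc' : (c : ℂ) ≠ 0 := by exact_mod_cast hc.ne'
  have ht' : (t : ℂ) ≠ 0 := by exact_mod_cast ht.ne'
  rw [sum_eq_of_two_valued h] at hs
  have h0 : (#{i | f i ≠ -c} : ℂ) = 0 :=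
    mul_left_cancel₀ (mul_ne_zero ht' hc') (by linear_combination hs)
  rw [Nat.cast_eq_zero, Finset.card_eq_zero, Finset.filter_eq_empty_iff] at h0
  refine Multiset.eq_replicate.2 ⟨by simp, fun b hb => ?_⟩
  obtain ⟨i, -, rfl⟩ := Multiset.mem_map.1 hb
  simpa using h0 (mem_univ i)

lemma map_eq_cons_replicate_of_sum (hc : 0 < c) (ht : 0 < t)
    (h : ∀ i, f i = -c ∨ f i = ((t : ℂ) - 1) * c) (hs : ∑ i, f i = 0) :
    (univ : Finset (Fin t)).val.map f =
      ((t : ℂ) - 1) * (c : ℂ) ::ₘ Multiset.replicate (t - 1) (-(c : ℂ)) := by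
  classical
  have hc' : (c : ℂ) ≠ 0 := by exact_mod_cast hc.ne'
  have ht' : (t : ℂ) ≠ 0 := by exact_mod_cast ht.ne'
  rw [sum_eq_of_two_valued h] at hs
  have h0 : (#{i | f i ≠ -c} : ℂ) = 1 :=
    mul_left_cancel₀ (mul_ne_zero ht' hc') (by linear_combination hs)
  rw [Nat.cast_eq_one, Finset.card_eq_one] at h0
  obtain ⟨a, ha⟩ := h0
  have hmem : ∀ i, f i ≠ -c ↔ i = a := fun i => by
    simpa using Finset.ext_iff.1 ha i
  rw [← Multiset.cons_erase (Finset.mem_univ_val a), Multiset.map_cons,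
    (h a).resolve_left ((hmem a).2 rfl)]
  congr 1
  refine Multiset.eq_replicate.2 ⟨by simp [Multiset.card_erase_of_mem], fun b hb => ?_⟩
  obtain ⟨i, hi, rfl⟩ := Multiset.mem_map.1 hb
  by_contra hne
  rw [← Finset.erase_val, Finset.mem_val] at hi
  exact Finset.ne_of_mem_erase hi ((hmem i).1 hne)

end TwoValued

lemma charTransform_sum_indicator [CommGroup G] [Fintype G] {ι : Type*} [Fintype ι]
    (P : ι → Set G) (χ : G →* ℂˣ) :
    charTransform (fun g => ∑ i, (P i).indicator 1 g) χ = ∑ i, charSum χ (P i) := by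
  simp only [charSum_eq_charTransform, charTransform, Finset.sum_mul]
  exact Finset.sum_comm

/-- A finite family partitions `A` exactly when its indicator functions sum to that of `A`. -/
lemma disjoint_and_iUnion_eq_iff {α ι : Type*} [Fintype ι] (P : ι → Set α) (A : Set α) :
    ((∀ i j, i ≠ j → Disjoint (P i) (P j)) ∧ ⋃ i, P i = A) ↔
      (fun a => ∑ i, (P i).indicator (1 : α → ℂ) a) = A.indicator 1 := by
  classical
  have key : ∀ a, ∑ i, (P i).indicator (1 : α → ℂ) a = #{i | a ∈ P i} := fun a => by
    simp [Set.indicator_apply]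
  simp only [key]
  constructor
  · rintro ⟨hd, rfl⟩
    funext a
    by_cases ha : a ∈ ⋃ i, P i
    · obtain ⟨i, hi⟩ := Set.mem_iUnion.1 ha
      rw [Set.indicator_of_mem ha, Pi.one_apply, Nat.cast_eq_one, Finset.card_eq_one]
      refine ⟨i, Finset.ext fun j => ?_⟩
      simp only [mem_filter, mem_univ, true_and, mem_singleton]
      refine ⟨fun hj => ?_, fun hj => hj ▸ hi⟩
      by_contra hne
      exact Set.disjoint_left.1 (hd j i hne) hj hi
    · rw [Set.indicator_of_notMem ha, Nat.cast_eq_zero, Finset.card_eq_zero,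
        Finset.filter_eq_empty_iff]
      exact fun i _ hi => ha (Set.mem_iUnion.2 ⟨i, hi⟩)
  · intro h
    have hcard : ∀ a, #{i | a ∈ P i} = if a ∈ A then 1 else 0 := fun a => by
      have := congrFun h a
      simp only [Set.indicator_apply, Pi.one_apply] at this
      exact_mod_cast this
    refine ⟨fun i j hij => Set.disjoint_left.2 fun a hi hj => hij ?_, Set.ext fun a => ?_⟩
    · have hle : #{i | a ∈ P i} ≤ 1 := by rw [hcard]; split_ifs <;> simp
      exact Finset.card_le_one.1 hle i (by simpa using hi) j (by simpa using hj)
    · have ha := hcard a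
      rw [Set.mem_iUnion]
      constructor
      · rintro ⟨i, hi⟩
        by_contra hA
        rw [if_neg hA, Finset.card_eq_zero, Finset.filter_eq_empty_iff] at ha
        exact ha (mem_univ i) hi
      · intro hA
        rw [if_pos hA] at ha
        obtain ⟨i, hi⟩ := Finset.card_pos.1 (ha.symm ▸ Nat.one_pos)
        exact ⟨i, by simpa using hi⟩

theorem stmt_3 {G : Type*} [CommGroup G] [Finite G] (c t : ℕ) (hc : 0 < c) (ht : 1 < t)
    (hG : Nat.card G = t ^ 2 * c ^ 2) (U : Subgroup G) (hU : Nat.card U = t * c)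
    (P : Fin t → Set G) (hP : ∀ i, Nat.card (P i) = c * (t * c - 1)) :
    IsLPPacking c t P U ↔
      ∀ χ : G →* ℂˣ, χ ≠ 1 →
        (IsPrincipalOn χ U → charMultiset χ P = Multiset.replicate t (-(c : ℂ))) ∧
        (¬ IsPrincipalOn χ U →
          charMultiset χ P =
            ((t : ℂ) - 1) * (c : ℂ) ::ₘ Multiset.replicate (t - 1) (-(c : ℂ))) := by
  classical
  cases nonempty_fintype G
  have ht0 : 0 < t := Nat.zero_lt_of_lt ht
  have hcompl : ∀ χ : G →* ℂˣ, χ ≠ 1 → (IsPrincipalOn χ U →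
      charSum χ (Set.univ \ (U : Set G)) = -(t * c)) ∧
      (¬ IsPrincipalOn χ U → charSum χ (Set.univ \ (U : Set G)) = 0) := fun χ hχ =>
    ⟨fun h => by
      rw [charSum_add_charSum_compl hχ, charSum_subgroup_of_isPrincipalOn h, hU, Nat.cast_mul],
    fun h => by
      rw [charSum_add_charSum_compl hχ, charSum_subgroup_of_not_isPrincipalOn h, neg_zero]⟩
  have hone : ⋃ i, P i = Set.univ \ (U : Set G) → ∀ i, (1 : G) ∉ P i := fun hu i hi =>
    (hu ▸ Set.mem_iUnion.2 ⟨i, hi⟩ : (1 : G) ∈ Set.univ \ (U : Set G)).2 U.one_mem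
  constructor
  · rintro ⟨-, -, hL, hd, hu⟩ χ hχ
    have hval := fun i =>
      (isLatinPDS_iff_charSum hc ht0 hG (hP i) (hone hu i)).1 (hL i) χ hχ
    have hsum : ∑ i, charSum χ (P i) = charSum χ (Set.univ \ (U : Set G)) := by
      rw [← charTransform_sum_indicator, (disjoint_and_iUnion_eq_iff P _).1 ⟨hd, hu⟩,
        charSum_eq_charTransform]
    exact ⟨fun h => map_eq_replicate_of_sum hc ht0 hval (hsum.trans ((hcompl χ hχ).1 h)),
      fun h => map_eq_cons_replicate_of_sum hc ht0 hval (hsum.trans ((hcompl χ hχ).2 h))⟩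
  · intro H
    have hval : ∀ i, ∀ χ : G →* ℂˣ, χ ≠ 1 →
        charSum χ (P i) = -c ∨ charSum χ (P i) = ((t : ℂ) - 1) * c := by
      intro i χ hχ
      have hmem : charSum χ (P i) ∈ charMultiset χ P :=
        Multiset.mem_map_of_mem _ (Finset.mem_univ_val i)
      by_cases h : IsPrincipalOn χ U
      · rw [(H χ hχ).1 h] at hmem
        exact Or.inl (Multiset.eq_of_mem_replicate hmem)
      · rw [(H χ hχ).2 h, Multiset.mem_cons] at hmem
        exact hmem.symm.imp_left Multiset.eq_of_mem_replicate
    have hsum : (fun g => ∑ i, (P i).indicator (1 : G → ℂ) g) =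
        (Set.univ \ (U : Set G)).indicator 1 := by
      refine charTransform_injective fun χ => ?_
      rw [charTransform_sum_indicator, ← charSum_eq_charTransform]
      by_cases hχ : χ = 1
      · subst hχ
        have hcard : Nat.card ↥(Set.univ \ (U : Set G)) = t ^ 2 * c ^ 2 - t * c := by
          rw [Nat.card_coe_set_eq, Set.ncard_sdiff (Set.subset_univ _), Set.ncard_univ, hG,
            ← Nat.card_coe_set_eq, SetLike.coe_sort_coe, hU]
        simp only [charSum_one, hP, hcard, sum_const, card_univ, Fintype.card_fin, nsmul_eq_mul]
        rw [← Nat.cast_mul, ← mul_assoc, Nat.mul_sub, mul_one]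
        congr 2
        ring
      · have hm : ∑ i, charSum χ (P i) = (charMultiset χ P).sum := rfl
        rw [hm]
        by_cases h : IsPrincipalOn χ U
        · rw [(H χ hχ).1 h, (hcompl χ hχ).1 h]
          simp
        · rw [(H χ hχ).2 h, (hcompl χ hχ).2 h]
          simp [Nat.cast_sub ht0]
    obtain ⟨hd, hu⟩ := (disjoint_and_iUnion_eq_iff P _).2 hsum
    exact ⟨hG, hU, fun i => (isLatinPDS_iff_charSum hc ht0 hG (hP i) (hone hu i)).2 (hval i),
      hd, hu⟩
end

section
/- For j = 1,2, suppose there exists a (c_j, t_j) LP-packing in an abelian group G_j of order t_j²c_j² relative to a subgroup U_j of order t_j·c_j, and suppose t₁ divides t₂. Then there exists a (t₂c₁c₂, t₁) LP-packing in G₁ × G₂ relative to U₁ × U₂. -/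
open Finset BigOperators

variable {G : Type*}

open MonoidAlgebra

/-- The sum of the elements of `D` in the rational group algebra. -/
noncomputable def setSum [Finite G] (D : Set G) : MonoidAlgebra ℚ G :=
  .ofCoeff (Finsupp.equivFunOnFinite.symm (D.indicator 1))

theorem coeff_setSum [Finite G] (D : Set G) (g : G) :
    (setSum D).coeff g = D.indicator 1 g := rfl

theorem setSum_eq_sum [Fintype G] (D : Set G) :
    setSum D = ∑ g, single g (D.indicator 1 g : ℚ) := by
  classical
  ext g
  simp [coeff_setSum, Finsupp.single_apply]

theorem coeff_mul_eq_sum [Group G] [Fintype G] (x y : MonoidAlgebra ℚ G) (g : G) :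
    (x * y).coeff g = ∑ h, x.coeff h * y.coeff (h⁻¹ * g) := by
  rw [coeff_mul_apply_left, Finsupp.sum_fintype]
  simp

theorem coeff_natCast_mul [Group G] (k : ℕ) (x : MonoidAlgebra ℚ G) (g : G) :
    ((k : MonoidAlgebra ℚ G) * x).coeff g = k * x.coeff g := by
  rw [← nsmul_eq_mul, ← Nat.cast_smul_eq_nsmul ℚ, coeff_smul_apply, smul_eq_mul]

theorem setSum_iUnion [Finite G] {ι : Type*} [Fintype ι] (P : ι → Set G)
    (hP : ∀ i j, i ≠ j → Disjoint (P i) (P j)) :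
    setSum (⋃ i, P i) = ∑ i, setSum (P i) := by
  classical
  ext g
  simp only [coeff_sum, Finsupp.coe_finsetSum, Finset.sum_apply, coeff_setSum]
  by_cases h : ∃ i, g ∈ P i
  · obtain ⟨i, hi⟩ := h
    rw [Set.indicator_of_mem (Set.mem_iUnion.2 ⟨i, hi⟩), Finset.sum_eq_single i]
    · simp [hi]
    · intro j _ hj
      exact Set.indicator_of_notMem (Set.disjoint_left.1 (hP i j hj.symm) hi) _
    · simp
  · push Not at h
    rw [Set.indicator_of_notMem (by simpa using h)]
    exact (Finset.sum_eq_zero fun i _ => Set.indicator_of_notMem (h i) _).symm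

theorem setSum_union [Finite G] {D E : Set G} (h : Disjoint D E) :
    setSum (D ∪ E) = setSum D + setSum E := by
  ext g
  simp only [coeff_setSum, coeff_add, Finsupp.coe_add, Pi.add_apply]
  rw [Set.indicator_union_of_disjoint h]

theorem setSum_univ_diff [Finite G] (D : Set G) :
    setSum (Set.univ \ D) = setSum Set.univ - setSum D := by
  rw [eq_sub_iff_add_eq, ← setSum_union Set.disjoint_sdiff_left]
  simp

theorem sum_indicator_one [Fintype G] (D : Set G) :
    ∑ g, D.indicator (1 : G → ℚ) g = Nat.card D := by
  classical
  simp [Set.indicator_apply, Nat.card_eq_fintype_card, Fintype.card_subtype]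

theorem setSum_mul_subgroup [Group G] [Finite G] {D : Set G} {H : Subgroup G}
    (hD : D ⊆ H) : setSum D * setSum (H : Set G) = Nat.card D * setSum (H : Set G) := by
  cases nonempty_fintype G
  ext g
  have key (h : G) : D.indicator (1 : G → ℚ) h * (H : Set G).indicator 1 (h⁻¹ * g) =
      D.indicator (1 : G → ℚ) h * (H : Set G).indicator 1 g := by
    by_cases hh : h ∈ D
    · congr 1
      have := H.mul_mem_cancel_left (x := h⁻¹) (y := g) (H.inv_mem (hD hh))
      by_cases hg : g ∈ H <;> simp [hg, this]
    · simp [hh]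
  rw [coeff_mul_eq_sum]
  simp only [coeff_setSum, key, ← Finset.sum_mul, sum_indicator_one]
  rw [coeff_natCast_mul, coeff_setSum]

theorem setSum_mul_univ [Group G] [Finite G] (D : Set G) :
    setSum D * setSum (Set.univ : Set G) = (Nat.card D : MonoidAlgebra ℚ G) * setSum Set.univ :=
  setSum_mul_subgroup (H := ⊤) (Set.subset_univ D)

theorem coeff_setSum_mul_self [Group G] [Finite G] (D : Set G) (g : G) :
    (setSum D * setSum D).coeff g = Nat.card {h : G // h ∈ D ∧ h⁻¹ * g ∈ D} := by
  cases nonempty_fintype G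
  rw [coeff_mul_eq_sum, ← Set.coe_ofPred, ← sum_indicator_one]
  refine Finset.sum_congr rfl fun h _ => ?_
  by_cases h1 : h ∈ D <;> by_cases h2 : h⁻¹ * g ∈ D <;> simp [coeff_setSum, h1, h2]

theorem coeff_setSum_mul_self_one [Group G] [Finite G] {D : Set G} (hD : D⁻¹ = D) :
    (setSum D * setSum D).coeff 1 = Nat.card D := by
  rw [coeff_setSum_mul_self]
  congr 1
  refine Nat.card_congr (Equiv.subtypeEquivRight fun h => ?_)
  rw [mul_one, ← Set.mem_inv, hD, and_self]

theorem coeff_setSum_mul_self_of_ne_one [Group G] [Finite G] {D : Set G} (hD : D⁻¹ = D) {g : G}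
    (hg : g ≠ 1) : (setSum D * setSum D).coeff g = diffCount D g := by
  rw [coeff_setSum_mul_self, diffCount]
  congr 1
  have hinv (x : G) : x⁻¹ ∈ D ↔ x ∈ D := by rw [← Set.mem_inv, hD]
  refine Nat.card_congr
    { toFun := fun h => ⟨(h.1, g⁻¹ * h.1), h.2.1, ?_, ?_, ?_⟩
      invFun := fun p => ⟨p.1.1, p.2.1, ?_⟩
      left_inv := fun h => rfl
      right_inv := fun p => ?_ }
  · rw [← hinv]; simpa using h.2.2
  · simpa using hg
  · simp
  · obtain ⟨⟨x, y⟩, hx, hy, hxy, rfl⟩ := p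
    simpa [hinv] using hy
  · obtain ⟨⟨x, y⟩, hx, hy, hxy, rfl⟩ := p
    simp

/-- Linear extension of inversion to the group algebra of a commutative group. -/
noncomputable def involute [CommGroup G] : MonoidAlgebra ℚ G →+* MonoidAlgebra ℚ G :=
  mapDomainRingHom ℚ (invMonoidHom : G →* G)

theorem coeff_involute [CommGroup G] (x : MonoidAlgebra ℚ G) (g : G) :
    (involute x).coeff g = x.coeff g⁻¹ := by
  have := Finsupp.mapDomain_apply (inv_injective (G := G)) x.coeff g⁻¹
  rw [inv_inv] at this
  exact this

theorem involute_setSum [CommGroup G] [Finite G] {D : Set G} (hD : D⁻¹ = D) :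
    involute (setSum D) = setSum D := by
  ext g
  rw [coeff_involute, coeff_setSum, coeff_setSum]
  have : g⁻¹ ∈ D ↔ g ∈ D := by rw [← Set.mem_inv, hD]
  by_cases h : g ∈ D <;> simp [this, h]

theorem coeff_one_of_isIdempotentElem [CommGroup G] [Fintype G] {x : MonoidAlgebra ℚ G}
    (hs : involute x = x) (hx : IsIdempotentElem x) : x.coeff 1 = ∑ g, x.coeff g ^ 2 := by
  conv_lhs => rw [← hx.eq, coeff_mul_eq_sum]
  refine Finset.sum_congr rfl fun g _ => ?_
  rw [mul_one, ← coeff_involute, hs, sq]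

theorem pairwise_mul_eq_zero_of_isIdempotentElem_sum [CommGroup G] [Finite G]
    {ι : Type*} [Fintype ι] {h : ι → MonoidAlgebra ℚ G}
    (hs : ∀ i, involute (h i) = h i) (hi : ∀ i, IsIdempotentElem (h i))
    (hsum : IsIdempotentElem (∑ i, h i)) {i j : ι} (hij : i ≠ j) : h i * h j = 0 := by
  classical
  cases nonempty_fintype G
  have hc (i j : ι) := coeff_one_of_isIdempotentElem (x := h i * h j)
    (by rw [map_mul, hs, hs]) ((hi i).mul (hi j))
  have hnn (i j : ι) : 0 ≤ (h i * h j).coeff 1 := by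
    rw [hc]; exact Finset.sum_nonneg fun g _ => sq_nonneg _
  have hle (i : ι) : (h i).coeff 1 ≤ ∑ j, (h i * h j).coeff 1 := by
    have := Finset.single_le_sum (fun j _ => hnn i j) (Finset.mem_univ i)
    rwa [(hi i).eq] at this
  have heq : ∑ i, (h i).coeff 1 = ∑ i, ∑ j, (h i * h j).coeff 1 := by
    have := congrArg (fun x => x.coeff 1) hsum.eq
    simpa [Finset.sum_mul_sum, coeff_sum] using this.symm
  have hrow := (Finset.sum_eq_sum_iff_of_le fun i _ => hle i).1 heq i (Finset.mem_univ i)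
  rw [← Finset.add_sum_erase _ _ (Finset.mem_univ i), (hi i).eq, left_eq_add,
    Finset.sum_eq_zero_iff_of_nonneg fun j _ => hnn i j] at hrow
  have h0 := hrow j (by simp [hij.symm])
  rw [hc, Finset.sum_eq_zero_iff_of_nonneg fun g _ => sq_nonneg _] at h0
  ext g
  simpa using h0 g (Finset.mem_univ g)

theorem natCast_mul_algebraMap_inv [CommGroup G] {n : ℕ} (hn : 0 < n) :
    (n : MonoidAlgebra ℚ G) * algebraMap ℚ (MonoidAlgebra ℚ G) (n : ℚ)⁻¹ = 1 := by
  rw [← map_natCast (algebraMap ℚ (MonoidAlgebra ℚ G)), ← map_mul,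
    mul_inv_cancel₀ (by exact_mod_cast hn.ne'), map_one]

/-- The element of the group algebra attached to `D` which is an idempotent orthogonal to the sum
of all group elements exactly when `D` is an `(n,r)` Latin square type PDS. -/
noncomputable def latinIdem [CommGroup G] [Finite G] (n r : ℕ) (D : Set G) : MonoidAlgebra ℚ G :=
  algebraMap ℚ (MonoidAlgebra ℚ G) (n : ℚ)⁻¹ *
    (setSum D + r - r * algebraMap ℚ (MonoidAlgebra ℚ G) (n : ℚ)⁻¹ * setSum (Set.univ : Set G))

theorem setSum_eq_latinIdem [CommGroup G] [Finite G] {n : ℕ} (hn : 0 < n) (r : ℕ) (D : Set G) :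
    setSum D = n * latinIdem n r D - r +
      r * algebraMap ℚ (MonoidAlgebra ℚ G) (n : ℚ)⁻¹ * setSum (Set.univ : Set G) := by
  rw [latinIdem, ← mul_assoc, natCast_mul_algebraMap_inv hn]
  ring

theorem involute_algebraMap [CommGroup G] (q : ℚ) :
    involute (algebraMap ℚ (MonoidAlgebra ℚ G) q) = algebraMap ℚ (MonoidAlgebra ℚ G) q := by
  simp [involute]

theorem involute_latinIdem [CommGroup G] [Finite G] (n r : ℕ) {D : Set G} (hD : D⁻¹ = D) :
    involute (latinIdem n r D) = latinIdem n r D := by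
  simp only [latinIdem, map_mul, map_add, map_sub, map_natCast, involute_algebraMap,
    involute_setSum hD, involute_setSum (D := (Set.univ : Set G)) Set.inv_univ]

theorem latinIdem_mul_univ_eq_zero_iff [CommGroup G] [Finite G] {n r : ℕ} {D : Set G}
    (hG : Nat.card G = n ^ 2) (hn : 0 < n) :
    latinIdem n r D * setSum (Set.univ : Set G) = 0 ↔ Nat.card D = r * (n - 1) := by
  have hν := natCast_mul_algebraMap_inv (G := G) hn
  have hD := setSum_mul_univ D
  have hU := setSum_mul_univ (Set.univ : Set G)
  rw [Nat.card_univ, hG] at hU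
  push_cast at hU
  have hcard : Nat.card D = r * (n - 1) ↔ Nat.card D + r = r * n := by
    obtain ⟨m, rfl⟩ := Nat.exists_eq_add_of_lt hn
    simp [mul_add]
  rw [hcard, latinIdem]
  set ν := algebraMap ℚ (MonoidAlgebra ℚ G) (n : ℚ)⁻¹
  constructor
  · intro h
    have h2 : ((Nat.card D + r : ℕ) : MonoidAlgebra ℚ G) * setSum (Set.univ : Set G) =
        ((r * n : ℕ) : MonoidAlgebra ℚ G) * setSum (Set.univ : Set G) := by
      push_cast
      linear_combination n * h - (setSum D + r - r * ν * setSum (Set.univ : Set G)) * setSum (Set.univ : Set G) * hν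
        - hD + r * ν * hU + r * n * setSum (Set.univ : Set G) * hν
    have h3 := congrArg (fun x => x.coeff 1) h2
    simp only [coeff_natCast_mul, coeff_setSum, Set.indicator_univ, Pi.one_apply, mul_one] at h3
    exact_mod_cast h3
  · intro h
    have h2 := congrArg (Nat.cast (R := MonoidAlgebra ℚ G)) h
    push_cast at h2
    linear_combination ν * hD - ν * r * ν * hU - r * n * ν * setSum (Set.univ : Set G) * hν
      + ν * setSum (Set.univ : Set G) * h2

theorem isIdempotentElem_latinIdem_iff [CommGroup G] [Finite G] {n r : ℕ} {D : Set G}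
    (hG : Nat.card G = n ^ 2) (hn : 0 < n) (hc : Nat.card D = r * (n - 1)) :
    IsIdempotentElem (latinIdem n r D) ↔
      setSum D * setSum D = (n - 2 * r) * setSum D + (n * r - r ^ 2)
        + (r ^ 2 - r) * setSum (Set.univ : Set G) := by
  have hν := natCast_mul_algebraMap_inv (G := G) hn
  have hz := (latinIdem_mul_univ_eq_zero_iff (D := D) (r := r) hG hn).2 hc
  have hD := setSum_mul_univ D
  have hc' : (Nat.card D : MonoidAlgebra ℚ G) = r * n - r := by
    rw [hc]; push_cast [Nat.cast_sub hn]; ring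
  rw [hc'] at hD
  have hL : (n : MonoidAlgebra ℚ G) * latinIdem n r D =
      setSum D + r - r * algebraMap ℚ (MonoidAlgebra ℚ G) (n : ℚ)⁻¹ * setSum (Set.univ : Set G) := by
    linear_combination -setSum_eq_latinIdem hn r D
  set L := latinIdem n r D
  set ν := algebraMap ℚ (MonoidAlgebra ℚ G) (n : ℚ)⁻¹
  have hLL : (n : MonoidAlgebra ℚ G) ^ 2 * (L * L) =
      setSum D * setSum D + 2 * r * setSum D + r ^ 2 - r ^ 2 * setSum (Set.univ : Set G) := by
    linear_combination (setSum D + r) * hL - r * ν * n * hz + n * L * hL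
      - r * ν * hD - r ^ 2 * setSum (Set.univ : Set G) * hν
  have hnL : (n : MonoidAlgebra ℚ G) ^ 2 * L =
      n * setSum D + n * r - r * setSum (Set.univ : Set G) := by
    linear_combination n * hL - r * setSum (Set.univ : Set G) * hν
  rw [IsIdempotentElem]
  constructor
  · intro h
    rw [h] at hLL
    linear_combination hnL - hLL
  · intro h
    linear_combination ν ^ 2 * hLL - ν ^ 2 * hnL + ν ^ 2 * h
      - (n * ν + 1) * (L * L - L) * hν

theorem isLatinPDS_iff [CommGroup G] [Finite G] {n r : ℕ} {D : Set G}
    (hG : Nat.card G = n ^ 2) (hn : 0 < n) (h1 : 1 ∉ D) (hD : D⁻¹ = D) :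
    IsLatinPDS D n r ↔
      IsIdempotentElem (latinIdem n r D) ∧ latinIdem n r D * setSum (Set.univ : Set G) = 0 := by
  classical
  have hcoeff (a b c : ℤ) (g : G) :
      ((a : MonoidAlgebra ℚ G) * setSum D + b + c * setSum (Set.univ : Set G)).coeff g =
        a * D.indicator 1 g + b * (if g = 1 then 1 else 0) + c := by
    have hb : (b : MonoidAlgebra ℚ G) = (b : ℚ) • 1 := by
      rw [Int.cast_smul_eq_zsmul, zsmul_eq_mul, mul_one]
    rw [← zsmul_eq_mul, ← zsmul_eq_mul, hb, ← Int.cast_smul_eq_zsmul ℚ,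
      ← Int.cast_smul_eq_zsmul ℚ]
    simp [coeff_setSum, one_def, Finsupp.single_apply, eq_comm]
  rw [latinIdem_mul_univ_eq_zero_iff hG hn]
  refine ⟨fun h => ⟨?_, h.1.2.1⟩, fun ⟨h, hc⟩ => ⟨⟨hG, hc, fun g hg => ?_⟩, h1, hD⟩⟩
  · have hc := h.1.2.1
    rw [isIdempotentElem_latinIdem_iff hG hn hc]
    ext g
    have := hcoeff (n - 2 * r) (n * r - r ^ 2) (r ^ 2 - r) g
    push_cast at this
    rw [this]
    by_cases hg : g = 1
    · subst hg
      rw [coeff_setSum_mul_self_one hD, hc]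
      push_cast [Nat.cast_sub hn]
      simp [h1]
      ring
    · rw [coeff_setSum_mul_self_of_ne_one hD hg]
      have hd := h.1.2.2 g hg
      by_cases hgD : g ∈ D
      · have := congrArg (Int.cast (R := ℚ)) (hd.1 hgD)
        push_cast at this
        rw [this]
        simp [hgD, hg]
        ring
      · have := congrArg (Int.cast (R := ℚ)) (hd.2 hgD)
        push_cast at this
        rw [this]
        simp [hgD, hg]
  · rw [isIdempotentElem_latinIdem_iff hG hn hc] at h
    have h2 := congrArg (fun x => x.coeff g) h
    have := hcoeff (n - 2 * r) (n * r - r ^ 2) (r ^ 2 - r) g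
    push_cast at this
    simp only [this, coeff_setSum_mul_self_of_ne_one hD hg, if_neg hg] at h2
    constructor <;> intro hgD
    · rw [Set.indicator_of_mem hgD] at h2
      have h3 : (diffCount D g : ℚ) = n + r ^ 2 - 3 * r := by rw [h2, Pi.one_apply]; ring
      exact_mod_cast h3
    · rw [Set.indicator_of_notMem hgD] at h2
      have h3 : (diffCount D g : ℚ) = r ^ 2 - r := by rw [h2]; ring
      exact_mod_cast h3

/-- The normalized sum of the elements of a subgroup, an idempotent of the group algebra. -/
noncomputable def subgroupIdem [CommGroup G] [Finite G] (n : ℕ) (U : Subgroup G) :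
    MonoidAlgebra ℚ G :=
  algebraMap ℚ (MonoidAlgebra ℚ G) (n : ℚ)⁻¹ * setSum (U : Set G)

theorem setSum_eq_subgroupIdem [CommGroup G] [Finite G] {n : ℕ} (hn : 0 < n) (U : Subgroup G) :
    setSum (U : Set G) = n * subgroupIdem n U := by
  rw [subgroupIdem, ← mul_assoc, natCast_mul_algebraMap_inv hn, one_mul]

theorem isIdempotentElem_subgroupIdem [CommGroup G] [Finite G] {n : ℕ} {U : Subgroup G}
    (hn : 0 < n) (hU : Nat.card U = n) : IsIdempotentElem (subgroupIdem n U) := by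
  have hν := natCast_mul_algebraMap_inv (G := G) hn
  have h := setSum_mul_subgroup (subset_refl (U : Set G))
  rw [show Nat.card (U : Set G) = n from hU] at h
  rw [IsIdempotentElem, subgroupIdem]
  set ν := algebraMap ℚ (MonoidAlgebra ℚ G) (n : ℚ)⁻¹
  linear_combination ν ^ 2 * h + ν * setSum (U : Set G) * hν

namespace IsLPPacking

variable [CommGroup G] {c t : ℕ} {P : Fin t → Set G} {U : Subgroup G}

theorem card_eq (h : IsLPPacking c t P U) : Nat.card G = (t * c) ^ 2 := by
  rw [h.1, mul_pow]

variable [Finite G]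

theorem pos (h : IsLPPacking c t P U) : 0 < t * c := by
  have := h.1 ▸ Nat.card_pos (α := G)
  rw [← mul_pow] at this
  exact Nat.pos_of_ne_zero fun h0 => by simp [h0] at this

theorem latinIdem_spec (h : IsLPPacking c t P U) (i : Fin t) :
    IsIdempotentElem (latinIdem (t * c) c (P i)) ∧
      latinIdem (t * c) c (P i) * setSum (Set.univ : Set G) = 0 :=
  (isLatinPDS_iff h.card_eq h.pos (h.2.2.1 i).2.1 (h.2.2.1 i).2.2).1 (h.2.2.1 i)

theorem sum_latinIdem (h : IsLPPacking c t P U) :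
    ∑ i, latinIdem (t * c) c (P i) = 1 - subgroupIdem (t * c) U := by
  have hν := natCast_mul_algebraMap_inv (G := G) h.pos
  have hs := setSum_iUnion P h.2.2.2.1
  rw [h.2.2.2.2, setSum_univ_diff] at hs
  simp only [latinIdem, subgroupIdem, ← Finset.mul_sum, Finset.sum_sub_distrib,
    Finset.sum_add_distrib, ← hs, Finset.sum_const, Finset.card_univ, Fintype.card_fin,
    nsmul_eq_mul]
  set ν := algebraMap ℚ (MonoidAlgebra ℚ G) ((t * c : ℕ) : ℚ)⁻¹
  push_cast at hν
  linear_combination (1 - ν * setSum (Set.univ : Set G)) * hν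

theorem latinIdem_mul_latinIdem (h : IsLPPacking c t P U) {i j : Fin t} (hij : i ≠ j) :
    latinIdem (t * c) c (P i) * latinIdem (t * c) c (P j) = 0 := by
  refine pairwise_mul_eq_zero_of_isIdempotentElem_sum
    (h := fun i => latinIdem (t * c) c (P i))
    (fun i => involute_latinIdem _ _ (h.2.2.1 i).2.2) (fun i => (h.latinIdem_spec i).1) ?_ hij
  rw [h.sum_latinIdem]
  exact (isIdempotentElem_subgroupIdem h.pos h.2.1).one_sub

theorem latinIdem_mul_subgroupIdem (h : IsLPPacking c t P U) (i : Fin t) :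
    latinIdem (t * c) c (P i) * subgroupIdem (t * c) U = 0 := by
  have hs := congrArg (latinIdem (t * c) c (P i) * ·) h.sum_latinIdem
  simp only [Finset.mul_sum] at hs
  rw [Finset.sum_eq_single i (fun j _ hj => h.latinIdem_mul_latinIdem hj.symm) (by simp),
    (h.latinIdem_spec i).1.eq] at hs
  linear_combination hs

/-- Merging blocks of `s` sets of an LP-packing gives an LP-packing with fewer sets. -/
theorem merge {s : ℕ} {P : Fin (t * s) → Set G} (h : IsLPPacking c (t * s) P U) :
    IsLPPacking (s * c) t (fun a => ⋃ b, P (finProdFinEquiv (a, b))) U := by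
  have hn : t * (s * c) = t * s * c := (mul_assoc t s c).symm
  have hdisj (i j : Fin t × Fin s) (hij : i ≠ j) :
      Disjoint (P (finProdFinEquiv i)) (P (finProdFinEquiv j)) :=
    h.2.2.2.1 _ _ (finProdFinEquiv.injective.ne hij)
  refine ⟨by rw [h.1]; ring, by rw [h.2.1, hn], fun a => ?_, fun a a' ha => ?_, ?_⟩
  · have hsum : latinIdem (t * s * c) (s * c) (⋃ b, P (finProdFinEquiv (a, b))) =
        ∑ b, latinIdem (t * s * c) c (P (finProdFinEquiv (a, b))) := by
      rw [latinIdem, setSum_iUnion _ fun b b' hb => hdisj _ _ (by simpa using hb)]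
      simp only [latinIdem, ← Finset.mul_sum, Finset.sum_sub_distrib,
        Finset.sum_add_distrib, Finset.sum_const, Finset.card_univ, Fintype.card_fin,
        nsmul_eq_mul]
      push_cast
      ring
    rw [hn, isLatinPDS_iff h.card_eq h.pos, hsum]
    · refine ⟨?_, ?_⟩
      · rw [IsIdempotentElem, Finset.sum_mul_sum]
        refine Finset.sum_congr rfl fun b _ => ?_
        rw [Finset.sum_eq_single b, (h.latinIdem_spec _).1.eq]
        · intro b' _ hb
          exact h.latinIdem_mul_latinIdem (finProdFinEquiv.injective.ne (by simpa using hb.symm))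
        · simp
      · rw [Finset.sum_mul]
        exact Finset.sum_eq_zero fun b _ => (h.latinIdem_spec _).2
    · simpa using fun b => (h.2.2.1 (finProdFinEquiv (a, b))).2.1
    · rw [Set.iUnion_inv]
      exact Set.iUnion_congr fun b => (h.2.2.1 _).2.2
  · simp only [Set.disjoint_iUnion_left, Set.disjoint_iUnion_right]
    exact fun b b' => hdisj _ _ (by simp [ha])
  · rw [← h.2.2.2.2, ← finProdFinEquiv.surjective.iUnion_comp, Set.iUnion_prod']

end IsLPPacking

theorem mapDomainRingHom_setSum_mul {G₁ G₂ : Type*} [CommGroup G₁] [Finite G₁] [CommGroup G₂]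
    [Finite G₂] (D : Set G₁) (E : Set G₂) :
    mapDomainRingHom ℚ (MonoidHom.inl G₁ G₂) (setSum D) *
      mapDomainRingHom ℚ (MonoidHom.inr G₁ G₂) (setSum E) = setSum (D ×ˢ E) := by
  cases nonempty_fintype G₁
  cases nonempty_fintype G₂
  simp only [setSum_eq_sum, map_sum, Finset.sum_mul_sum, Fintype.sum_prod_type]
  refine Finset.sum_congr rfl fun x _ => Finset.sum_congr rfl fun y _ => ?_
  by_cases hx : x ∈ D <;> by_cases hy : y ∈ E <;>
    simp [hx, hy, mapDomainRingHom, single_mul_single]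

/-- The `i`-th set of the product of two families indexed by `Fin t`. -/
def productSet {G₁ G₂ : Type*} [CommGroup G₁] [CommGroup G₂] {t : ℕ} [NeZero t]
    (P : Fin t → Set G₁) (Q : Fin t → Set G₂) (U₁ : Subgroup G₁) (U₂ : Subgroup G₂) (i : Fin t) :
    Set (G₁ × G₂) :=
  (⋃ j, P j ×ˢ Q (i - j)) ∪ (P i ×ˢ U₂ ∪ (U₁ : Set G₁) ×ˢ Q i)

theorem isIdempotentElem_convolution {B : Type*} [CommRing B] {t : ℕ} [NeZero t]
    {e f : Fin t → B} {u v : B} (he : ∀ i, IsIdempotentElem (e i))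
    (hf : ∀ i, IsIdempotentElem (f i)) (hu : IsIdempotentElem u) (hv : IsIdempotentElem v)
    (hee : ∀ i j, i ≠ j → e i * e j = 0) (heu : ∀ i, e i * u = 0) (hfv : ∀ i, f i * v = 0)
    (i : Fin t) :
    IsIdempotentElem (∑ j, e j * f (i - j) + (e i * v + u * f i)) := by
  set S := ∑ j, e j * f (i - j) with hS
  have hSS : S * S = S := by
    rw [hS, Finset.sum_mul_sum]
    refine Finset.sum_congr rfl fun j _ => ?_
    rw [Finset.sum_eq_single j]
    · exact ((he j).mul (hf (i - j))).eq
    · intro k _ hk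
      linear_combination f (i - j) * f (i - k) * hee j k hk.symm
    · simp
  have hSu : S * u = 0 := by
    rw [hS, Finset.sum_mul]
    exact Finset.sum_eq_zero fun j _ => by linear_combination f (i - j) * heu j
  have hSv : S * v = 0 := by
    rw [hS, Finset.sum_mul]
    exact Finset.sum_eq_zero fun j _ => by linear_combination e j * hfv (i - j)
  rw [IsIdempotentElem]
  linear_combination hSS + 2 * e i * hSv + 2 * f i * hSu + 2 * v * f i * heu i
    + ((he i).mul hv).eq + (hu.mul (hf i)).eq

section Product

variable {G₁ G₂ : Type*} [CommGroup G₁] [CommGroup G₂] {t c₁ c₂ : ℕ} [NeZero t]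
  {P : Fin t → Set G₁} {Q : Fin t → Set G₂} {U₁ : Subgroup G₁} {U₂ : Subgroup G₂}

theorem mem_productSet {i : Fin t} {x : G₁ × G₂} :
    x ∈ productSet P Q U₁ U₂ i ↔ (∃ j, x.1 ∈ P j ∧ x.2 ∈ Q (i - j)) ∨
      (x.1 ∈ P i ∧ x.2 ∈ U₂) ∨ (x.1 ∈ U₁ ∧ x.2 ∈ Q i) := by
  simp [productSet]

theorem IsLPPacking.notMem_subgroup {G : Type*} [CommGroup G] {c t : ℕ} {P : Fin t → Set G}
    {U : Subgroup G} (h : IsLPPacking c t P U) {i : Fin t} {x : G} (hx : x ∈ P i) : x ∉ U := by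
  have : x ∈ ⋃ i, P i := Set.mem_iUnion.2 ⟨i, hx⟩
  rw [h.2.2.2.2] at this
  exact this.2

theorem IsLPPacking.exists_mem {G : Type*} [CommGroup G] {c t : ℕ} {P : Fin t → Set G}
    {U : Subgroup G} (h : IsLPPacking c t P U) {x : G} (hx : x ∉ U) : ∃ i, x ∈ P i := by
  rw [← Set.mem_iUnion, h.2.2.2.2]
  exact ⟨trivial, hx⟩

theorem IsLPPacking.eq_of_mem {G : Type*} [CommGroup G] {c t : ℕ} {P : Fin t → Set G}
    {U : Subgroup G} (h : IsLPPacking c t P U) {i j : Fin t} {x : G} (hi : x ∈ P i)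
    (hj : x ∈ P j) : i = j := by
  by_contra hij
  exact Set.disjoint_left.1 (h.2.2.2.1 i j hij) hi hj

theorem disjoint_productSet (h₁ : IsLPPacking c₁ t P U₁) (h₂ : IsLPPacking c₂ t Q U₂)
    {i i' : Fin t} (hi : i ≠ i') :
    Disjoint (productSet P Q U₁ U₂ i) (productSet P Q U₁ U₂ i') := by
  rw [Set.disjoint_left]
  rintro ⟨x, y⟩ hx hx'
  rw [mem_productSet] at hx hx'
  rcases hx with ⟨j, hj, hj'⟩ | ⟨hx, hy⟩ | ⟨hx, hy⟩ <;>
    rcases hx' with ⟨k, hk, hk'⟩ | ⟨hz, hw⟩ | ⟨hz, hw⟩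
  · obtain rfl := h₁.eq_of_mem hj hk
    exact hi (sub_left_injective (h₂.eq_of_mem hj' hk'))
  · exact h₂.notMem_subgroup hj' hw
  · exact h₁.notMem_subgroup hj hz
  · exact h₂.notMem_subgroup hk' hy
  · exact hi (h₁.eq_of_mem hx hz)
  · exact h₁.notMem_subgroup hx hz
  · exact h₁.notMem_subgroup hk hx
  · exact h₁.notMem_subgroup hz hx
  · exact hi (h₂.eq_of_mem hy hw)

theorem iUnion_productSet (h₁ : IsLPPacking c₁ t P U₁) (h₂ : IsLPPacking c₂ t Q U₂) :
    ⋃ i, productSet P Q U₁ U₂ i = Set.univ \ (U₁.prod U₂ : Set (G₁ × G₂)) := by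
  ext ⟨x, y⟩
  simp only [Set.mem_iUnion, mem_productSet, Set.mem_sdiff, Set.mem_univ, true_and,
    SetLike.mem_coe, Subgroup.mem_prod, not_and]
  constructor
  · rintro ⟨i, ⟨j, hj, hj'⟩ | ⟨hx, hy⟩ | ⟨hx, hy⟩⟩ hx'
    · exact h₂.notMem_subgroup hj'
    · exact absurd hx' (h₁.notMem_subgroup hx)
    · exact h₂.notMem_subgroup hy
  · intro h
    by_cases hx : x ∈ U₁
    · obtain ⟨i, hi⟩ := h₂.exists_mem (h hx)
      exact ⟨i, .inr (.inr ⟨hx, hi⟩)⟩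
    · obtain ⟨i, hi⟩ := h₁.exists_mem hx
      by_cases hy : y ∈ U₂
      · exact ⟨i, .inr (.inl ⟨hi, hy⟩)⟩
      · obtain ⟨j, hj⟩ := h₂.exists_mem hy
        exact ⟨j + i, .inl ⟨i, hi, by simpa using hj⟩⟩

theorem inv_productSet (hP : ∀ i, (P i)⁻¹ = P i) (hQ : ∀ i, (Q i)⁻¹ = Q i) (i : Fin t) :
    (productSet P Q U₁ U₂ i)⁻¹ = productSet P Q U₁ U₂ i := by
  have hP' (i : Fin t) (x : G₁) : x⁻¹ ∈ P i ↔ x ∈ P i := by rw [← Set.mem_inv, hP]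
  have hQ' (i : Fin t) (x : G₂) : x⁻¹ ∈ Q i ↔ x ∈ Q i := by rw [← Set.mem_inv, hQ]
  ext ⟨x, y⟩
  simp [mem_productSet, hP', hQ']

theorem setSum_productSet [Finite G₁] [Finite G₂] (h₁ : IsLPPacking c₁ t P U₁)
    (h₂ : IsLPPacking c₂ t Q U₂) (i : Fin t) :
    setSum (productSet P Q U₁ U₂ i) =
      ∑ j, setSum (P j ×ˢ Q (i - j)) +
        (setSum (P i ×ˢ (U₂ : Set G₂)) + setSum ((U₁ : Set G₁) ×ˢ Q i)) := by
  rw [productSet, setSum_union, setSum_iUnion, setSum_union]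
  · exact Set.disjoint_prod.2 (.inl (Set.disjoint_left.2 fun x => h₁.notMem_subgroup))
  · exact fun j k hjk => Set.disjoint_prod.2 (.inl (h₁.2.2.2.1 j k hjk))
  · rw [Set.disjoint_iUnion_left]
    refine fun j => Set.disjoint_union_right.2 ⟨?_, ?_⟩
    · exact Set.disjoint_prod.2 (.inr (Set.disjoint_left.2 fun x => h₂.notMem_subgroup))
    · exact Set.disjoint_prod.2 (.inl (Set.disjoint_left.2 fun x => h₁.notMem_subgroup))

theorem latinIdem_productSet [Finite G₁] [Finite G₂] (h₁ : IsLPPacking c₁ t P U₁)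
    (h₂ : IsLPPacking c₂ t Q U₂) (i : Fin t) :
    latinIdem (t * (t * c₁ * c₂)) (t * c₁ * c₂) (productSet P Q U₁ U₂ i) =
      ∑ j, mapDomainRingHom ℚ (MonoidHom.inl G₁ G₂) (latinIdem (t * c₁) c₁ (P j)) *
        mapDomainRingHom ℚ (MonoidHom.inr G₁ G₂) (latinIdem (t * c₂) c₂ (Q (i - j))) +
      (mapDomainRingHom ℚ (MonoidHom.inl G₁ G₂) (latinIdem (t * c₁) c₁ (P i)) *
          mapDomainRingHom ℚ (MonoidHom.inr G₁ G₂) (subgroupIdem (t * c₂) U₂) +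
        mapDomainRingHom ℚ (MonoidHom.inl G₁ G₂) (subgroupIdem (t * c₁) U₁) *
          mapDomainRingHom ℚ (MonoidHom.inr G₁ G₂) (latinIdem (t * c₂) c₂ (Q i))) := by
  have hpos : 0 < t * (t * c₁ * c₂) := by
    have := Nat.mul_pos h₁.pos h₂.pos
    rwa [show t * (t * c₁ * c₂) = t * c₁ * (t * c₂) by ring]
  set φ := mapDomainRingHom ℚ (MonoidHom.inl G₁ G₂) with hφ
  set ψ := mapDomainRingHom ℚ (MonoidHom.inr G₁ G₂) with hψ
  have hν := natCast_mul_algebraMap_inv (G := G₁ × G₂) hpos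
  have hν₁ := congrArg φ (natCast_mul_algebraMap_inv (G := G₁) h₁.pos)
  have hν₂ := congrArg ψ (natCast_mul_algebraMap_inv (G := G₂) h₂.pos)
  have hs₁ := congrArg φ h₁.sum_latinIdem
  have hs₂ := congrArg ψ h₂.sum_latinIdem
  rw [map_sum, map_sub, map_one] at hs₁ hs₂
  rw [map_mul, map_natCast, map_one] at hν₁ hν₂
  have hP (j : Fin t) := congrArg φ (setSum_eq_latinIdem h₁.pos c₁ (P j))
  have hQ (j : Fin t) := congrArg ψ (setSum_eq_latinIdem h₂.pos c₂ (Q j))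
  have hU₁ := congrArg φ (setSum_eq_subgroupIdem h₁.pos U₁)
  have hU₂ := congrArg ψ (setSum_eq_subgroupIdem h₂.pos U₂)
  simp only [map_mul, map_add, map_sub, map_natCast] at hP hQ hU₁ hU₂
  have hs₂' : ∑ j, ψ (latinIdem (t * c₂) c₂ (Q (i - j))) =
      1 - ψ (subgroupIdem (t * c₂) U₂) := by
    rw [← hs₂]
    exact Equiv.sum_comp (Equiv.subLeft i) fun j => ψ (latinIdem (t * c₂) c₂ (Q j))
  rw [latinIdem, setSum_productSet h₁ h₂, ← Set.univ_prod_univ]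
  simp only [← mapDomainRingHom_setSum_mul, ← hφ, ← hψ, hP, hQ, hU₁, hU₂]
  generalize φ (algebraMap ℚ (MonoidAlgebra ℚ G₁) ((t * c₁ : ℕ) : ℚ)⁻¹) = ν₁ at *
  generalize ψ (algebraMap ℚ (MonoidAlgebra ℚ G₂) ((t * c₂ : ℕ) : ℚ)⁻¹) = ν₂ at *
  generalize algebraMap ℚ (MonoidAlgebra ℚ (G₁ × G₂)) _ = ν at *
  generalize φ (setSum Set.univ) = Γ₁ at *
  generalize ψ (setSum Set.univ) = Γ₂ at *
  generalize φ (subgroupIdem (t * c₁) U₁) = u₁ at *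
  generalize ψ (subgroupIdem (t * c₂) U₂) = u₂ at *
  generalize hE : (fun j => φ (latinIdem (t * c₁) c₁ (P j))) = E at *
  generalize hF : (fun j => ψ (latinIdem (t * c₂) c₂ (Q j))) = F at *
  replace hE (j : Fin t) : φ (latinIdem (t * c₁) c₁ (P j)) = E j := congrFun hE j
  replace hF (j : Fin t) : ψ (latinIdem (t * c₂) c₂ (Q j)) = F j := congrFun hF j
  simp only [hE, hF] at *
  push_cast at *
  have hexp : ∑ j, (t * c₁ * E j - c₁ + c₁ * ν₁ * Γ₁) *
      (t * c₂ * F (i - j) - c₂ + c₂ * ν₂ * Γ₂) =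
      t ^ 2 * c₁ * c₂ * ∑ j, E j * F (i - j)
        + t * c₁ * (c₂ * ν₂ * Γ₂ - c₂) * ∑ j, E j
        + t * c₂ * (c₁ * ν₁ * Γ₁ - c₁) * ∑ j, F (i - j)
        + t * ((c₁ * ν₁ * Γ₁ - c₁) * (c₂ * ν₂ * Γ₂ - c₂)) := by
    have hconst (b : MonoidAlgebra ℚ (G₁ × G₂)) : t * b = ∑ _j : Fin t, b := by simp
    rw [hconst ((c₁ * ν₁ * Γ₁ - c₁) * (c₂ * ν₂ * Γ₂ - c₂)), Finset.mul_sum, Finset.mul_sum, Finset.mul_sum, ← Finset.sum_add_distrib,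
      ← Finset.sum_add_distrib, ← Finset.sum_add_distrib]
    exact Finset.sum_congr rfl fun j _ => by ring
  rw [hexp, hs₁, hs₂']
  generalize ∑ j, E j * F (i - j) = S at *
  have hνν : ν₁ * ν₂ = ν := by
    linear_combination ν₁ * ν₂ * (-hν) + ν * ν₂ * t * c₂ * hν₁ + ν * hν₂
  subst hνν
  linear_combination (S + E i * u₂ + u₁ * F i) * hν

/-- The product of two LP-packings with equally many sets is an LP-packing. -/
theorem IsLPPacking.productSet [Finite G₁] [Finite G₂] (h₁ : IsLPPacking c₁ t P U₁)
    (h₂ : IsLPPacking c₂ t Q U₂) :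
    IsLPPacking (t * c₁ * c₂) t (productSet P Q U₁ U₂) (U₁.prod U₂) := by
  have hcard : Nat.card (G₁ × G₂) = (t * (t * c₁ * c₂)) ^ 2 := by
    rw [Nat.card_prod, h₁.1, h₂.1]; ring
  have hpos : 0 < t * (t * c₁ * c₂) := by
    have := Nat.mul_pos h₁.pos h₂.pos
    rwa [show t * (t * c₁ * c₂) = t * c₁ * (t * c₂) by ring]
  refine ⟨by rw [hcard]; ring, ?_, fun i => ?_, fun i j hij => disjoint_productSet h₁ h₂ hij,
    iUnion_productSet h₁ h₂⟩
  · rw [Nat.card_congr (U₁.prodEquiv U₂).toEquiv, Nat.card_prod, h₁.2.1, h₂.2.1]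
    ring
  · rw [isLatinPDS_iff hcard hpos, latinIdem_productSet h₁ h₂]
    · constructor
      · refine isIdempotentElem_convolution (fun j => (h₁.latinIdem_spec j).1.map _)
          (fun j => (h₂.latinIdem_spec j).1.map _)
          ((isIdempotentElem_subgroupIdem h₁.pos h₁.2.1).map _)
          ((isIdempotentElem_subgroupIdem h₂.pos h₂.2.1).map _) (fun j k hjk => ?_)
          (fun j => ?_) (fun j => ?_) i
        · rw [← map_mul, h₁.latinIdem_mul_latinIdem hjk, map_zero]
        · rw [← map_mul, h₁.latinIdem_mul_subgroupIdem, map_zero]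
        · rw [← map_mul, h₂.latinIdem_mul_subgroupIdem, map_zero]
      · have hz₁ (j : Fin t) := congrArg (mapDomainRingHom ℚ (MonoidHom.inl G₁ G₂))
          (h₁.latinIdem_spec j).2
        have hz₂ (j : Fin t) := congrArg (mapDomainRingHom ℚ (MonoidHom.inr G₁ G₂))
          (h₂.latinIdem_spec j).2
        simp only [map_mul, map_zero] at hz₁ hz₂
        rw [← Set.univ_prod_univ, ← mapDomainRingHom_setSum_mul]
        set φ := mapDomainRingHom ℚ (MonoidHom.inl G₁ G₂)
        set ψ := mapDomainRingHom ℚ (MonoidHom.inr G₁ G₂)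
        have hS : (∑ j, φ (latinIdem (t * c₁) c₁ (P j)) * ψ (latinIdem (t * c₂) c₂ (Q (i - j)))) *
            φ (setSum Set.univ) = 0 := by
          rw [Finset.sum_mul]
          exact Finset.sum_eq_zero fun j _ => by
            linear_combination ψ (latinIdem (t * c₂) c₂ (Q (i - j))) * hz₁ j
        linear_combination ψ (setSum Set.univ) * hS +
          ψ (subgroupIdem (t * c₂) U₂) * ψ (setSum Set.univ) * hz₁ i +
          φ (subgroupIdem (t * c₁) U₁) * φ (setSum Set.univ) * hz₂ i
    · have hP (j : Fin t) : (1 : G₁) ∉ P j := (h₁.2.2.1 j).2.1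
      have hQ (j : Fin t) : (1 : G₂) ∉ Q j := (h₂.2.2.1 j).2.1
      simp [mem_productSet, hP, hQ]
    · exact inv_productSet (fun j => (h₁.2.2.1 j).2.2) (fun j => (h₂.2.2.1 j).2.2) i

end Product

theorem stmt_10 {G1 G2 : Type*} [CommGroup G1] [Finite G1] [CommGroup G2] [Finite G2]
    (c1 c2 t1 t2 : ℕ) (U1 : Subgroup G1) (U2 : Subgroup G2)
    (h1 : ∃ P : Fin t1 → Set G1, IsLPPacking c1 t1 P U1)
    (h2 : ∃ P : Fin t2 → Set G2, IsLPPacking c2 t2 P U2)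
    (hdvd : t1 ∣ t2) :
    ∃ K : Fin t1 → Set (G1 × G2), IsLPPacking (t2 * c1 * c2) t1 K (U1.prod U2) := by
  obtain ⟨P, hP⟩ := h1
  obtain ⟨Q, hQ⟩ := h2
  obtain ⟨s, rfl⟩ := hdvd
  have : NeZero t1 := ⟨(Nat.pos_of_mul_pos_right hP.pos).ne'⟩
  have h := hP.productSet hQ.merge
  rw [show t1 * c1 * (s * c2) = t1 * s * c1 * c2 by ring] at h
  exact ⟨_, h⟩
end

section
/- Let p be prime and a, s positive integers. Let G = (Z_{p^a})^{2s}, let H₀ be the unique subgroup of G isomorphic to (Z_p)^s contained in the first s direct factors, and let V₀ ≅ (Z_{p^a})^s × (Z_{p^{a-1}})^s be the unique subgroup containing H₀ with V₀/H₀ ≅ (Z_{p^{a-1}})^{2s}. Then there exists a (p^{(a-1)s}, p^s) LP-partition in G − V₀ relative to H₀. -/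
open Finset BigOperators

variable {G : Type*}

/-- A finite-free extension of `ZMod (p ^ a)` of rank `s` with residue field of order `p ^ s`
(a Galois ring). -/
theorem exists_galoisRing (p a s : ℕ) (hp : p.Prime) (ha : 0 < a) (hs : 0 < s) :
    ∃ (R : Type) (_ : CommRing R), Finite R ∧ Nonempty (R ≃+ (Fin s → ZMod (p ^ a))) ∧
      Nat.card (R ⧸ Ideal.span {(p : R)}) = p ^ s ∧
      ∀ x : R, x ∉ Ideal.span {(p : R)} → IsUnit x := by
  have : Fact p.Prime := ⟨hp⟩
  have : NeZero (p ^ a) := ⟨pow_ne_zero _ hp.ne_zero⟩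
  let red : ZMod (p ^ a) →+* ZMod p := ZMod.castHom (dvd_pow_self p ha.ne') (ZMod p)
  have red_surj : Function.Surjective red := ZMod.castHom_surjective _
  obtain ⟨α, hα⟩ := Field.exists_primitive_element (ZMod p) (GaloisField p s)
  have hint : IsIntegral (ZMod p) α := Algebra.IsIntegral.isIntegral α
  have hdeg : (minpoly (ZMod p) α).natDegree = s := by
    rw [(Field.primitive_element_iff_minpoly_natDegree_eq (ZMod p) α).1 hα,
      GaloisField.finrank p hs.ne']
  obtain ⟨f, hfmap, hfdeg, hf⟩ := Polynomial.lifts_and_natDegree_eq_and_monic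
    (f := red) (p := minpoly (ZMod p) α)
    ((Polynomial.mem_lifts _).2 (Polynomial.map_surjective red red_surj _)) (minpoly.monic hint)
  have eval_eq (P : Polynomial (ZMod (p ^ a))) :
      P.eval₂ ((algebraMap (ZMod p) (GaloisField p s)).comp red) α
        = Polynomial.aeval α (P.map red) := by
    rw [Polynomial.aeval_def, Polynomial.eval₂_map]
  let φ : AdjoinRoot f →+* GaloisField p s :=
    AdjoinRoot.lift ((algebraMap (ZMod p) (GaloisField p s)).comp red) α
      (by rw [eval_eq, hfmap, minpoly.aeval])
  have φ_mk (P) : φ (AdjoinRoot.mk f P) = Polynomial.aeval α (P.map red) := by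
    rw [← eval_eq]; exact AdjoinRoot.lift_mk _ _
  have φ_surj : Function.Surjective φ := by
    intro x
    have hx : x ∈ (IntermediateField.adjoin (ZMod p) {α}).toSubalgebra := by simp [hα]
    rw [IntermediateField.adjoin_simple_toSubalgebra_of_isAlgebraic hint.isAlgebraic,
      Algebra.adjoin_singleton_eq_range_aeval] at hx
    obtain ⟨Q, rfl⟩ := hx
    obtain ⟨P, rfl⟩ := Polynomial.map_surjective red red_surj Q
    exact ⟨AdjoinRoot.mk f P, φ_mk P⟩
  have hker : RingHom.ker φ = Ideal.span {(p : AdjoinRoot f)} := by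
    apply le_antisymm
    · intro x hx
      obtain ⟨P, rfl⟩ := AdjoinRoot.mk_surjective x
      rw [RingHom.mem_ker, φ_mk] at hx
      obtain ⟨Q, hQ⟩ := minpoly.dvd _ _ hx
      obtain ⟨Q, rfl⟩ := Polynomial.map_surjective red red_surj Q
      rw [← hfmap, ← Polynomial.map_mul] at hQ
      have : (Polynomial.C (p : ZMod (p ^ a))) ∣ P - f * Q := by
        rw [Polynomial.C_dvd_iff_dvd_coeff]
        intro i
        have hi : red ((P - f * Q).coeff i) = 0 := by
          rw [← Polynomial.coeff_map, Polynomial.map_sub, hQ, sub_self, Polynomial.coeff_zero]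
        generalize (P - f * Q).coeff i = z at hi
        obtain ⟨n, rfl⟩ := ZMod.natCast_zmod_surjective z
        rw [map_natCast, ZMod.natCast_eq_zero_iff] at hi
        exact_mod_cast Nat.cast_dvd_cast hi
      obtain ⟨T, hT⟩ := this
      have := congrArg (AdjoinRoot.mk f) hT
      simp only [map_sub, map_mul, AdjoinRoot.mk_self, zero_mul, sub_zero] at this
      rw [this, Ideal.mem_span_singleton]
      exact ⟨AdjoinRoot.mk f T, by simp⟩
    · rw [Ideal.span_singleton_le_iff_mem, RingHom.mem_ker, map_natCast, CharP.cast_eq_zero]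
  let b := (AdjoinRoot.powerBasis' hf).basis
  have hdim : (AdjoinRoot.powerBasis' hf).dim = s := by
    rw [AdjoinRoot.powerBasis'_dim, hfdeg, hdeg]
  let e : AdjoinRoot f ≃+ (Fin s → ZMod (p ^ a)) :=
    (b.equivFun.trans (LinearEquiv.funCongrLeft _ _ (finCongr hdim.symm))).toAddEquiv
  refine ⟨AdjoinRoot f, inferInstance, Finite.of_equiv _ e.symm.toEquiv, ⟨e⟩, ?_, ?_⟩
  · rw [← hker, Nat.card_congr (RingHom.quotientKerEquivOfSurjective φ_surj).toEquiv,
      GaloisField.card p s hs.ne']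
  · intro x hx
    rw [← hker, RingHom.mem_ker] at hx
    obtain ⟨y, hy⟩ := φ_surj (φ x)⁻¹
    have hxy : x * y - 1 ∈ RingHom.ker φ := by
      rw [RingHom.mem_ker, map_sub, map_mul, hy, mul_inv_cancel₀ hx, map_one, sub_self]
    rw [hker, Ideal.mem_span_singleton] at hxy
    have hnil : IsNilpotent (x * y - 1) := by
      obtain ⟨z, hz⟩ := hxy
      refine ⟨a, ?_⟩
      have hpa : (p : AdjoinRoot f) ^ a = 0 := by
        have := congrArg (AdjoinRoot.of f) (ZMod.natCast_self (p ^ a))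
        rwa [map_natCast, map_zero, Nat.cast_pow] at this
      rw [hz, mul_pow, hpa, zero_mul]
    have := hnil.isUnit_add_one
    rw [sub_add_cancel] at this
    exact isUnit_of_mul_isUnit_left this

/-- `R` is partitioned into `q = |J|` transversals of the ideal `J`. -/
theorem exists_equiv_quotient_prod_fin {R : Type*} [CommRing R] (J : Ideal R) {q : ℕ} (hq : 0 < q)
    (hJ : Nat.card J = q) :
    ∃ E : (R ⧸ J) × Fin q ≃ R, ∀ b i, Ideal.Quotient.mk J (E (b, i)) = b := by
  have : Finite J := Nat.finite_of_card_ne_zero (by omega)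
  let f : J ≃ Fin q := Finite.equivFinOfCardEq hJ
  have hout (b : R ⧸ J) : Ideal.Quotient.mk J b.out = b := Quotient.out_eq b
  have hf (b : R ⧸ J) (i) : Ideal.Quotient.mk J (b.out + (f.symm i : R)) = b := by
    rw [map_add, hout, Ideal.Quotient.eq_zero_iff_mem.2 (f.symm i).2, add_zero]
  refine ⟨Equiv.ofBijective (fun x => x.1.out + (f.symm x.2 : R)) ⟨?_, ?_⟩, fun b i => hf b i⟩
  · rintro ⟨b, i⟩ ⟨b', i'⟩ h
    have hb := congrArg (Ideal.Quotient.mk J) h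
    simp only [hf] at hb
    subst hb
    simpa using h
  · intro x
    have hx : x - (Ideal.Quotient.mk J x).out ∈ J := by
      rw [← Ideal.Quotient.eq, hout]
    exact ⟨(Ideal.Quotient.mk J x, f ⟨_, hx⟩), by simp⟩

open Classical in
/-- Orthogonality for an additive character restricted to the complement of a subgroup. -/
theorem AddChar.sum_notMem_eq {A : Type*} [AddCommGroup A] [Fintype A] (ψ : AddChar A ℂ)
    (I : AddSubgroup A) :
    ∑ y : {y // y ∉ I}, ψ y
      = (if ∀ y, ψ y = 1 then (Nat.card A : ℂ) else 0)
        - (if ∀ y ∈ I, ψ y = 1 then (Nat.card I : ℂ) else 0) := by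
  have hsplit := Fintype.sum_subtype_add_sum_subtype (fun y => y ∈ I) (fun y => ψ y)
  have hA := AddChar.sum_eq_ite ψ
  have hI := AddChar.sum_eq_ite (ψ.compAddMonoidHom I.subtype)
  have h0 : ψ = 0 ↔ ∀ y, ψ y = 1 := AddChar.eq_zero_iff
  have h1 : ψ.compAddMonoidHom I.subtype = 0 ↔ ∀ y ∈ I, ψ y = 1 := by
    rw [AddChar.eq_zero_iff]; simp
  simp only [h0] at hA
  simp only [h1] at hI
  rw [Nat.card_eq_fintype_card, Nat.card_eq_fintype_card, ← hA, ← hI, ← hsplit]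
  simp

theorem charSum_subgroup [Group G] [Finite G] (χ : G →* ℂˣ) (V : Subgroup G) :
    (IsPrincipalOn χ V → charSum χ V = Nat.card V) ∧
      (¬ IsPrincipalOn χ V → charSum χ (V : Set G) = 0) := by
  classical
  have := Fintype.ofFinite G
  have h := sum_hom_units ((Units.coeHom ℂ).comp (χ.comp V.subtype))
  have h1 : charSum χ (V : Set G) = ∑ v : V, (χ v : ℂ) := by
    rw [charSum, ← finsum_set_coe_eq_finsum_mem, finsum_eq_sum_of_fintype]; rfl
  have h2 : (Units.coeHom ℂ).comp (χ.comp V.subtype) = 1 ↔ IsPrincipalOn χ V := by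
    simp [MonoidHom.ext_iff, IsPrincipalOn]
  simp only [h2] at h
  rw [h1]
  constructor <;> intro hV
  · simpa [hV] using h
  · simpa [hV] using h

theorem map_ite_eq_cons_replicate {q : ℕ} {A : Type*} (x y : A) (f : Fin q → A) (i₀ : Fin q)
    (h₀ : f i₀ = x) (h : ∀ i, i ≠ i₀ → f i = y) :
    (Finset.univ.val : Multiset (Fin q)).map f = x ::ₘ Multiset.replicate (q - 1) y := by
  rw [← Finset.insert_erase (Finset.mem_univ i₀),
    Finset.insert_val_of_notMem (Finset.notMem_erase _ _), Multiset.map_cons, h₀]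
  congr 1
  rw [Multiset.eq_replicate]
  simp only [Multiset.card_map, Finset.card_val, Finset.card_erase_of_mem, Finset.mem_univ,
    Finset.card_univ, Fintype.card_fin, true_and]
  intro b hb
  obtain ⟨i, hi, rfl⟩ := Multiset.mem_map.1 hb
  exact h i (Finset.ne_of_mem_erase (show i ∈ Finset.univ.erase i₀ from hi))

theorem map_eq_replicate {q : ℕ} {A : Type*} (y : A) (f : Fin q → A) (h : ∀ i, f i = y) :
    (Finset.univ.val : Multiset (Fin q)).map f = Multiset.replicate q y := by
  simp [h]

/-- Self-duality of a finite ring along a character whose kernel contains no nonzero ideal. -/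
theorem AddChar.exists_mulLeft_eq {R : Type*} [CommRing R] [Finite R] (α β : AddChar R ℂ)
    (hα : ∀ z, (∀ y, α (z * y) = 1) → z = 0) : ∃ z, ∀ y, α (z * y) = β y := by
  have := Fintype.ofFinite R
  let m : R → AddChar R ℂ := fun z => α.compAddMonoidHom (AddMonoidHom.mulLeft z)
  have hinj : Function.Injective m := by
    intro z w h
    refine sub_eq_zero.1 (hα _ fun y => ?_)
    have := DFunLike.congr_fun h y
    simp only [m, AddChar.compAddMonoidHom_apply, AddMonoidHom.coe_mulLeft] at this
    rw [sub_mul, AddChar.map_sub_eq_div, this, div_self]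
    exact (α.val_isUnit _).ne_zero
  have hbij := (Fintype.bijective_iff_injective_and_card m).2 ⟨hinj, AddChar.card_eq.symm⟩
  obtain ⟨z, hz⟩ := hbij.2 β
  exact ⟨z, fun y => DFunLike.congr_fun hz y⟩

/-- The LP-partition of `R × R` relative to `J × 0` whose parts are unions of punctured lines
`{(z * y, y) | y ∉ I}`, the slopes `z` running over transversals of the annihilator `J` of `π`,
where `I` is the ideal generated by `π`. -/
theorem exists_isLPPartition_of_ring {R : Type*} [CommRing R] [Finite R] [CommGroup G]
    (e : G ≃* Multiplicative (R × R)) (π : R) (J : Ideal R) (c q : ℕ)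
    (hunit : ∀ x ∉ Ideal.span {π}, IsUnit x)
    (hJ : ∀ x, x ∈ J ↔ x * π = 0)
    (hdvd : ∀ z, z ≠ 0 → ∀ x ∈ J, z ∣ x)
    (hcardJ : Nat.card J = q) (hcardI : Nat.card (Ideal.span {π}) = c)
    (hcardR : Nat.card R = q * c) (V H : Subgroup G)
    (hV : ∀ g, g ∈ V ↔ (e g).toAdd.2 ∈ Ideal.span {π})
    (hH : ∀ g, g ∈ H ↔ (e g).toAdd.1 ∈ J ∧ (e g).toAdd.2 = 0) :
    ∃ P : Fin q → Set G, IsLPPartition c q P V H := by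
  classical
  have := Fintype.ofFinite R
  have : Finite G := Finite.of_equiv _ e.symm.toEquiv
  set I := Ideal.span {π}
  have hq : 0 < q := hcardJ ▸ Nat.card_pos
  have hcardQ : Nat.card (R ⧸ J) = c := by
    have := AddSubgroup.card_eq_card_quotient_mul_card_addSubgroup J.toAddSubgroup
    have h : q * c = Nat.card (R ⧸ J) * q := by
      rw [← hcardR, ← hcardJ]; exact this
    exact Nat.eq_of_mul_eq_mul_right hq (by rw [← h, mul_comm])
  have hcardU : Nat.card {y // y ∉ I} = (q - 1) * c := by
    rw [Nat.card_eq_fintype_card, Fintype.card_subtype_compl, ← Nat.card_eq_fintype_card,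
      ← Nat.card_eq_fintype_card, hcardR, Nat.sub_mul, one_mul]
    exact congrArg _ hcardI
  obtain ⟨E, hE⟩ := exists_equiv_quotient_prod_fin J hq hcardJ
  let Φ (i : Fin q) (x : (R ⧸ J) × {y // y ∉ I}) : G :=
    e.symm (Multiplicative.ofAdd (E (x.1, i) * x.2, (x.2 : R)))
  have hΦ {i i' x x'} (h : Φ i x = Φ i' x') : i = i' ∧ x = x' := by
    obtain ⟨b, y, hy⟩ := x
    obtain ⟨b', y', hy'⟩ := x'
    simp only [Φ, EmbeddingLike.apply_eq_iff_eq, Prod.mk.injEq] at h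
    obtain ⟨h1, rfl⟩ := h
    have := E.injective ((hunit y hy).mul_right_cancel h1)
    simp_all
  have hcardG : Nat.card G = q ^ 2 * c ^ 2 := by
    rw [Nat.card_congr e.toEquiv, Nat.card_congr Multiplicative.toAdd, Nat.card_prod, hcardR]
    ring
  have hcardV : Nat.card V = q * c ^ 2 := by
    have h : Nat.card V = Nat.card (R × I) := by
      refine Nat.card_congr
        { toFun := fun g => ((e g).toAdd.1, ⟨(e g).toAdd.2, (hV g).1 g.2⟩)
          invFun := fun x => ⟨e.symm (Multiplicative.ofAdd (x.1, (x.2 : R))), by simp [hV]⟩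
          left_inv := fun g => by simp
          right_inv := fun x => by simp }
    rw [h, Nat.card_prod, hcardR, hcardI]
    ring
  have hunion : (⋃ i, Set.range (Φ i)) = Set.univ \ (V : Set G) := by
    ext g
    simp only [Set.mem_iUnion, Set.mem_range, Set.mem_sdiff, Set.mem_univ, true_and,
      SetLike.mem_coe]
    constructor
    · rintro ⟨i, ⟨b, y, hy⟩, rfl⟩
      simpa [hV, Φ] using hy
    · intro hg
      rw [hV] at hg
      obtain ⟨u, hu⟩ := hunit _ hg
      obtain ⟨⟨b, i⟩, hz⟩ := E.surjective ((e g).toAdd.1 * ↑u⁻¹)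
      refine ⟨i, (b, ⟨_, hg⟩), ?_⟩
      rw [MulEquiv.symm_apply_eq]
      simp only [hz, ← hu, Units.inv_mul_cancel_right]
      rw [hu]
      rfl
  have hdisj (i j) (hij : i ≠ j) : Disjoint (Set.range (Φ i)) (Set.range (Φ j)) := by
    rw [Set.disjoint_left]
    rintro _ ⟨x, rfl⟩ ⟨x', h⟩
    exact hij (hΦ h).1.symm
  have hHV : H ≤ V := fun g hg => by
    rw [hV, ((hH g).1 hg).2]; exact I.zero_mem
  refine ⟨fun i => Set.range (Φ i), hcardG, hcardV, hHV, ?_, hdisj, hunion, ?_⟩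
  · intro i
    rw [Nat.card_range_of_injective fun x x' h => (hΦ h).2, Nat.card_prod, hcardQ, hcardU]
    ring
  intro χ hχ
  let ψ : AddChar (R × R) ℂ :=
    { toFun := fun w => (χ (e.symm (Multiplicative.ofAdd w)) : ℂ)
      map_zero_eq_one' := by simp
      map_add_eq_mul' := fun v w => by simp [ofAdd_add] }
  have hsum (i) : charSum χ (Set.range (Φ i))
      = ∑ b : R ⧸ J, ∑ y : {y // y ∉ I}, ψ (E (b, i) * y, (y : R)) := by
    rw [charSum, finsum_mem_range fun x x' h => (hΦ h).2, finsum_eq_sum_of_fintype,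
      Fintype.sum_prod_type]
    rfl
  by_cases hχH : IsPrincipalOn χ H
  · have hψJ (j) (hj : j ∈ J) : ψ (j, 0) = 1 := by
      have := hχH (e.symm (Multiplicative.ofAdd (j, 0))) (by simp [hH, hj])
      simp [ψ, this]
    have hindep (i i') : charSum χ (Set.range (Φ i)) = charSum χ (Set.range (Φ i')) := by
      rw [hsum, hsum]
      refine Finset.sum_congr rfl fun b _ => Finset.sum_congr rfl fun y _ => ?_
      have hmem : E (b, i) - E (b, i') ∈ J := by rw [← Ideal.Quotient.eq, hE, hE]
      have : ((E (b, i) * y, (y : R)) : R × R)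
          = ((E (b, i) - E (b, i')) * y, 0) + (E (b, i') * y, (y : R)) := by
        ext <;> simp [sub_mul]
      rw [this, AddChar.map_add_eq_mul, hψJ _ (J.mul_mem_right _ hmem), one_mul]
    have htot : (q : ℂ) * (charSum χ (Set.range (Φ ⟨0, hq⟩))) = - charSum χ (V : Set G) := by
      have h1 : charSum χ (⋃ i, Set.range (Φ i)) = ∑ i, charSum χ (Set.range (Φ i)) := by
        rw [charSum, finsum_mem_iUnion (fun i j h => hdisj i j h) fun i => Set.toFinite _,
          finsum_eq_sum_of_fintype]
        rfl
      have h2 : charSum χ (V : Set G) + charSum χ (Set.univ \ (V : Set G)) = 0 := by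
        have h3 : charSum χ ((⊤ : Subgroup G) : Set G) = 0 :=
          (charSum_subgroup χ ⊤).2 fun h => hχ (MonoidHom.ext fun g => h g trivial)
        rw [← h3, Subgroup.coe_top, charSum, charSum, charSum,
          finsum_mem_add_sdiff (Set.subset_univ _) (Set.toFinite _)]
      rw [← hunion, h1, Finset.sum_congr rfl fun i _ => hindep i ⟨0, hq⟩] at h2
      simp only [Finset.sum_const, Finset.card_univ, Fintype.card_fin, nsmul_eq_mul] at h2
      linear_combination h2
    have hq0 : (q : ℂ) ≠ 0 := by exact_mod_cast hq.ne'
    refine ⟨fun hχV => map_eq_replicate _ _ fun i => ?_,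
      fun hχV _ => map_eq_replicate _ _ fun i => ?_, fun h => absurd hχH h⟩
    · rw [hindep i ⟨0, hq⟩]
      rw [(charSum_subgroup χ V).1 hχV, hcardV] at htot
      apply mul_left_cancel₀ hq0
      rw [htot]
      push_cast
      ring
    · rw [hindep i ⟨0, hq⟩]
      rw [(charSum_subgroup χ V).2 hχV, neg_zero] at htot
      exact (mul_eq_zero.1 htot).resolve_left hq0
  · refine ⟨fun h => absurd (fun u hu => h u (hHV hu)) hχH, fun _ h => absurd h hχH, fun _ => ?_⟩
    let α : AddChar R ℂ := ψ.compAddMonoidHom (AddMonoidHom.inl R R)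
    let β : AddChar R ℂ := ψ.compAddMonoidHom ((AddMonoidHom.inr R R).comp negAddMonoidHom)
    have hα (z : R) (hz : ∀ y, α (z * y) = 1) : z = 0 := by
      by_contra hz0
      refine hχH fun g hg => ?_
      obtain ⟨y, hy⟩ := hdvd z hz0 _ ((hH g).1 hg).1
      have h := hz y
      rw [← hy] at h
      have hg' : e.symm (Multiplicative.ofAdd ((e g).toAdd.1, 0)) = g := by
        rw [← ((hH g).1 hg).2]; simp
      simpa [α, ψ, hg'] using h
    obtain ⟨z₀, hz₀⟩ := AddChar.exists_mulLeft_eq α β hα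
    have hψ (z y : R) : ψ (z * y, y) = α ((z - z₀) * y) := by
      have : ((z * y, y) : R × R) = ((z - z₀) * y, 0) + (z₀ * y, 0) + (0, y) := by
        ext <;> simp [sub_mul]
      rw [this, AddChar.map_add_eq_mul, AddChar.map_add_eq_mul, mul_assoc]
      have h : ψ (z₀ * y, 0) = ψ (0, -y) := hz₀ y
      have h0 : ((0, -y) : R × R) + (0, y) = 0 := by ext <;> simp
      rw [h, ← AddChar.map_add_eq_mul, h0, AddChar.map_zero_eq_one, mul_one]
      rfl
    have hT (z : R) : ∑ y : {y // y ∉ I}, ψ (z * y, (y : R))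
        = (if z = z₀ then ((q * c : ℕ) : ℂ) else 0)
          - if Ideal.Quotient.mk J z = Ideal.Quotient.mk J z₀ then (c : ℂ) else 0 := by
      have h := AddChar.sum_notMem_eq (α.compAddMonoidHom (AddMonoidHom.mulLeft (z - z₀)))
        I.toAddSubgroup
      have h1 : (∀ y, α.compAddMonoidHom (AddMonoidHom.mulLeft (z - z₀)) y = 1) ↔ z = z₀ :=
        ⟨fun h => sub_eq_zero.1 (hα _ h), by rintro rfl; simp⟩
      have h2 : (∀ y ∈ I.toAddSubgroup,
          α.compAddMonoidHom (AddMonoidHom.mulLeft (z - z₀)) y = 1) ↔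
          Ideal.Quotient.mk J z = Ideal.Quotient.mk J z₀ := by
        rw [Ideal.Quotient.eq, hJ]
        constructor
        · intro h
          refine hα _ fun y => ?_
          rw [mul_assoc]
          exact h _ (I.mul_mem_right _ (Ideal.mem_span_singleton_self π))
        · intro h y hy
          obtain ⟨k, rfl⟩ := Ideal.mem_span_singleton.1 (show y ∈ Ideal.span {π} from hy)
          simp [← mul_assoc, h]
      have h3 : Nat.card I.toAddSubgroup = c := hcardI
      simp only [h1, h2, h3, hcardR] at h
      rw [← h]
      exact Finset.sum_congr rfl fun y _ => hψ z y
    have hval (i) : charSum χ (Set.range (Φ i))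
        = (if i = (E.symm z₀).2 then ((q * c : ℕ) : ℂ) else 0) - c := by
      have hb (b) : E (b, i) = z₀ ↔ b = (E.symm z₀).1 ∧ i = (E.symm z₀).2 := by
        rw [← Equiv.eq_symm_apply, Prod.ext_iff]
      simp only [hsum, hT, hb, hE, Finset.sum_sub_distrib, ite_and]
      simp
    apply map_ite_eq_cons_replicate _ _ _ (E.symm z₀).2
    · rw [hval, if_pos rfl]
      push_cast
      ring
    · intro i hi
      rw [hval, if_neg hi, zero_sub]

/-- In a ring whose nonunits are the multiples of a nilpotent `π`, every nonzero element is a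
power of `π` up to a unit. -/
theorem exists_eq_pow_mul_unit {R : Type*} [CommRing R] {π : R} {a : ℕ}
    (hunit : ∀ x ∉ Ideal.span {π}, IsUnit x) (hπ : π ^ a = 0) {z : R} (hz : z ≠ 0) :
    ∃ k, ∃ u : Rˣ, z = π ^ k * u := by
  classical
  have hex : ∃ k, ¬ (π ^ k ∣ z) := ⟨a, by rwa [hπ, zero_dvd_iff]⟩
  have hspec := Nat.find_spec hex
  have hpos : Nat.find hex ≠ 0 := fun h => by simp [h] at hspec
  obtain ⟨k, hk⟩ := Nat.exists_eq_succ_of_ne_zero hpos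
  obtain ⟨w, hw⟩ : π ^ k ∣ z := not_not.1 (Nat.find_min hex (by omega))
  rw [hk, pow_succ, hw] at hspec
  obtain ⟨u, hu⟩ := hunit w fun h =>
    hspec (mul_dvd_mul_left _ (Ideal.mem_span_singleton.1 h))
  exact ⟨k, u, by rw [hu, hw]⟩

/-- In a finite chain ring, the annihilator of the uniformizer `π` is the least nonzero ideal. -/
theorem dvd_of_mul_eq_zero_of_pow_eq_zero {R : Type*} [CommRing R] {π : R} {a : ℕ}
    (hunit : ∀ x ∉ Ideal.span {π}, IsUnit x) (hπ : π ^ a = 0) (hπ' : π ^ (a - 1) ≠ 0)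
    {z x : R} (hz : z ≠ 0) (hx : x * π = 0) : z ∣ x := by
  rcases eq_or_ne x 0 with rfl | hx0
  · exact dvd_zero z
  obtain ⟨k, u, rfl⟩ := exists_eq_pow_mul_unit hunit hπ hz
  obtain ⟨l, v, rfl⟩ := exists_eq_pow_mul_unit hunit hπ hx0
  have hk : k < a := by
    by_contra! hak
    exact hz (by rw [pow_eq_zero_of_le hak hπ, zero_mul])
  rw [Units.mul_right_dvd]
  refine dvd_mul_of_dvd_left (pow_dvd_pow _ ?_) _
  rw [mul_right_comm, Units.mul_left_eq_zero, ← pow_succ] at hx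
  by_contra hkl
  exact hπ' (pow_eq_zero_of_le (by omega) hx)

theorem stmt_13 (p a s : ℕ) (hp : p.Prime) (ha : 0 < a) (hs : 0 < s)
    (H0 V0 : Subgroup (Multiplicative (Fin (2 * s) → ZMod (p ^ a))))
    (hH0card : Nat.card H0 = p ^ s)
    (hH0exp : ∀ x ∈ H0, x ^ p = 1)
    (hH0first : ∀ x ∈ H0, ∀ j : Fin (2 * s), s ≤ (j : ℕ) → Multiplicative.toAdd x j = 0)
    (hle : H0 ≤ V0)
    (hV0 : Nonempty
      (V0 ≃* Multiplicative ((Fin s → ZMod (p ^ a)) × (Fin s → ZMod (p ^ (a - 1))))))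
    (hquot : Nonempty
      ((V0 ⧸ H0.subgroupOf V0) ≃* Multiplicative (Fin (2 * s) → ZMod (p ^ (a - 1))))) :
    ∃ R : Fin (p ^ s) → Set (Multiplicative (Fin (2 * s) → ZMod (p ^ a))),
      IsLPPartition (p ^ ((a - 1) * s)) (p ^ s) R V0 H0 := by
  have : NeZero (p ^ a) := ⟨pow_ne_zero _ hp.ne_zero⟩
  obtain ⟨R, _, hR, ⟨f⟩, hcardQ, hunit⟩ := exists_galoisRing p a s hp ha hs
  have hcardR : Nat.card R = p ^ (a * s) := by
    rw [Nat.card_congr f.toEquiv, Nat.card_fun, Nat.card_zmod, Nat.card_fin, pow_mul]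
  have hsplit : a * s = s + (a - 1) * s := by
    obtain ⟨k, rfl⟩ : ∃ k, a = k + 1 := ⟨a - 1, by omega⟩
    simp; ring
  let I : Ideal R := Ideal.span {(p : R)}
  let J : Ideal R := LinearMap.ker (LinearMap.mulRight R (p : R))
  have hJ (x : R) : x ∈ J ↔ x * p = 0 := by simp [J]
  have hcardI : Nat.card I = p ^ ((a - 1) * s) := by
    have h : Nat.card R = Nat.card (R ⧸ I) * Nat.card I :=
      AddSubgroup.card_eq_card_quotient_mul_card_addSubgroup I.toAddSubgroup
    rw [hcardR, hcardQ, hsplit, pow_add] at h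
    exact (Nat.eq_of_mul_eq_mul_left (pow_pos hp.pos s) h).symm
  have hcardJ : Nat.card J = p ^ s := by
    have h : Nat.card R = Nat.card (R ⧸ J) * Nat.card J :=
      AddSubgroup.card_eq_card_quotient_mul_card_addSubgroup J.toAddSubgroup
    have hrange : LinearMap.range (LinearMap.mulRight R (p : R)) = I := by
      ext x
      simp [I, Ideal.mem_span_singleton', LinearMap.mem_range]
    rw [Nat.card_congr (LinearMap.quotKerEquivRange (LinearMap.mulRight R (p : R))).toEquiv,
      hrange, hcardR, hcardI, hsplit, pow_add, mul_comm] at h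
    exact (Nat.eq_of_mul_eq_mul_left (pow_pos hp.pos _) h).symm
  have hpa : (p : R) ^ a = 0 := by
    apply f.injective
    have h : (p ^ a : ℕ) • f 1 = 0 := by
      ext i
      simp
    rw [map_zero, ← h, ← map_nsmul, nsmul_one, Nat.cast_pow]
  have hpa1 : (p : R) ^ (a - 1) ≠ 0 := by
    intro h0
    let v : Fin s → ZMod (p ^ a) := fun _ => 1
    have h : (p ^ (a - 1) : ℕ) • v = 0 := by
      rw [← f.apply_symm_apply v, ← map_nsmul, nsmul_eq_mul, Nat.cast_pow, h0, zero_mul, map_zero]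
    have h' := congrFun h ⟨0, hs⟩
    simp only [v, Pi.smul_apply, Pi.zero_apply, nsmul_one, ZMod.natCast_eq_zero_iff] at h'
    have := (Nat.pow_dvd_pow_iff_le_right hp.one_lt).1 h'
    omega
  have hdvd (z : R) (hz : z ≠ 0) (x : R) (hx : x ∈ J) : z ∣ x :=
    dvd_of_mul_eq_zero_of_pow_eq_zero hunit hpa hpa1 hz ((hJ x).1 hx)
  let e₀ : (Fin (2 * s) → ZMod (p ^ a)) ≃+ (Fin s → ZMod (p ^ a)) × (Fin s → ZMod (p ^ a)) :=
    ((LinearEquiv.funCongrLeft (ZMod (p ^ a)) (ZMod (p ^ a))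
      (finSumFinEquiv.trans (finCongr (two_mul s).symm))).trans
      (LinearEquiv.sumArrowLequivProdArrow _ _ _ _)).toAddEquiv
  have he₀ (x : Fin (2 * s) → ZMod (p ^ a)) (hx : ∀ j : Fin (2 * s), s ≤ (j : ℕ) → x j = 0) :
      (e₀ x).2 = 0 := by
    ext i
    exact hx _ (by simp)
  let e : Multiplicative (Fin (2 * s) → ZMod (p ^ a)) ≃* Multiplicative (R × R) :=
    AddEquiv.toMultiplicative (e₀.trans (f.symm.prodCongr f.symm))
  have card_comap (A : AddSubgroup (R × R)) :
      Nat.card ((AddSubgroup.toSubgroup A).comap e.toMonoidHom) = Nat.card A :=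
    Nat.card_congr (e.toEquiv.subtypeEquiv fun _ => Iff.rfl)
  let H₁ := (AddSubgroup.toSubgroup (J.toAddSubgroup.prod ⊥)).comap e.toMonoidHom
  let V₁ := (AddSubgroup.toSubgroup ((⊤ : AddSubgroup R).prod I.toAddSubgroup)).comap e.toMonoidHom
  have hH₁ (g) : g ∈ H₁ ↔ (e g).toAdd.1 ∈ J ∧ (e g).toAdd.2 = 0 := Iff.rfl
  have hV₁ (g) : g ∈ V₁ ↔ (e g).toAdd.2 ∈ I := ⟨fun h => h.2, fun h => ⟨trivial, h⟩⟩
  have hH : H0 = H₁ := by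
    refine Subgroup.eq_of_le_of_card_ge (fun g hg => (hH₁ g).2 ⟨?_, ?_⟩) ?_
    · have h : p • (e g).toAdd = 0 := by
        rw [← toAdd_pow, ← map_pow, hH0exp g hg, map_one, toAdd_one]
      rw [hJ, mul_comm, ← nsmul_eq_mul]
      exact congrArg Prod.fst h
    · show f.symm (e₀ g.toAdd).2 = 0
      rw [he₀ _ (hH0first g hg), map_zero]
    · rw [card_comap, Nat.card_congr (AddSubgroup.prodEquiv _ _).toEquiv, Nat.card_prod, hH0card,
        AddSubgroup.card_bot, mul_one]
      exact hcardJ.le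
  have hV : V0 = V₁ := by
    refine Subgroup.eq_of_le_of_card_ge (fun g hg => (hV₁ g).2 ?_) ?_
    · by_contra hgI
      obtain ⟨φ⟩ := hquot
      have hq : ((⟨g, hg⟩ : V0) : V0 ⧸ H0.subgroupOf V0) ^ p ^ (a - 1) = 1 := by
        apply φ.injective
        rw [map_pow, map_one]
        apply Multiplicative.toAdd.injective
        ext i
        simp
      have hmem : g ^ p ^ (a - 1) ∈ H₁ := by
        rw [← QuotientGroup.mk_pow, QuotientGroup.eq_one_iff, Subgroup.mem_subgroupOf, hH] at hq
        exact hq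
      have h0 := ((hH₁ _).1 hmem).2
      rw [map_pow, toAdd_pow, Prod.smul_snd, nsmul_eq_mul, (hunit _ hgI).mul_left_eq_zero,
        Nat.cast_pow] at h0
      exact hpa1 h0
    · obtain ⟨φ⟩ := hquot
      have h : Nat.card V0 = p ^ (a * s) * p ^ ((a - 1) * s) := by
        rw [Subgroup.card_eq_card_quotient_mul_card_subgroup (H0.subgroupOf V0),
          Nat.card_congr φ.toEquiv, Nat.card_congr (Subgroup.subgroupOfEquivOfLe hle).toEquiv,
          hH0card, Nat.card_congr Multiplicative.toAdd, Nat.card_fun, Nat.card_zmod,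
          Nat.card_fin, hsplit, ← pow_mul, ← pow_add, ← pow_add]
        congr 1
        ring
      rw [h, card_comap, Nat.card_congr (AddSubgroup.prodEquiv _ _).toEquiv, Nat.card_prod,
        AddSubgroup.card_top, hcardR]
      exact (congrArg _ hcardI).le
  refine exists_isLPPartition_of_ring e (p : R) J _ _ hunit hJ hdvd hcardJ hcardI ?_ V0 H0
    (fun g => hV ▸ hV₁ g) fun g => hH ▸ hH₁ g
  rw [hcardR, hsplit, pow_add]
end
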